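/- arXiv:2508.15696 — 10 statements merged into one kernel-verified Lean document; each statement's English description precedes it below -/
import Mathlib

section
/- Let r > 0. The function μ : ℝ → (0,∞) defined by μ(t) = ln(t + e) for t ≥ 0 and μ(t) = 1/ln(e − t) for t ≤ 0 is a differentiable growth rate, and it satisfies condition (H) with constant N = ln²(e + r/2); that is, μ(s+r)/μ(s) ≤ ln²(e + r/2) for all s ∈ ℝ. -/
open Filter MeasureTheory

lemma aux_one_le (x : ℝ) (hx : 0 ≤ x) : 1 ≤ Real.log (x + Real.exp 1) := by
  rw [Real.le_log_iff_exp_le (by positivity)]; linarith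

lemma aux_lt (x y : ℝ) (hx : 0 ≤ x) (h : x < y) :
    Real.log (x + Real.exp 1) < Real.log (y + Real.exp 1) :=
  Real.log_lt_log (by positivity) (by linarith)

lemma aux_mul (x y : ℝ) (hx : 0 ≤ x) (hy : 0 ≤ y) :
    Real.log (x + y + Real.exp 1) ≤ Real.log (x + Real.exp 1) * Real.log (y + Real.exp 1) := by
  have h1 := aux_one_le x hx
  have h2 := aux_one_le y hy
  have he := Real.exp_pos 1
  have h3 : Real.log (x + y + Real.exp 1) + 1 ≤
      Real.log (x + Real.exp 1) + Real.log (y + Real.exp 1) := by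
    have : Real.log (x + y + Real.exp 1) + Real.log (Real.exp 1) ≤
        Real.log (x + Real.exp 1) + Real.log (y + Real.exp 1) := by
      rw [← Real.log_mul (by positivity) (by positivity),
        ← Real.log_mul (by positivity) (by positivity)]
      apply Real.log_le_log (by positivity)
      nlinarith [mul_nonneg hx hy]
    rwa [Real.log_exp] at this
  nlinarith [mul_nonneg (sub_nonneg.2 h1) (sub_nonneg.2 h2)]

lemma aux_amgm (x y : ℝ) (hx : 0 ≤ x) (hy : 0 ≤ y) :
    Real.log (x + Real.exp 1) * Real.log (y + Real.exp 1) ≤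
      (Real.log (Real.exp 1 + (x + y) / 2)) ^ 2 := by
  have h1 := aux_one_le x hx
  have h2 := aux_one_le y hy
  have he := Real.exp_pos 1
  have h3 : Real.log (x + Real.exp 1) + Real.log (y + Real.exp 1) ≤
      2 * Real.log (Real.exp 1 + (x + y) / 2) := by
    rw [← Real.log_mul (by positivity) (by positivity), two_mul,
        ← Real.log_mul (by positivity) (by positivity)]
    apply Real.log_le_log (by positivity)
    nlinarith [sq_nonneg (x - y)]
  nlinarith [sq_nonneg (Real.log (x + Real.exp 1) - Real.log (y + Real.exp 1))]

/-- The piecewise function `μ(t) = ln(t + e)` for `t ≥ 0` and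
`μ(t) = 1/ln(e − t)` for `t ≤ 0` is a differentiable growth rate satisfying
condition (H) with constant `N = ln²(e + r/2)`. -/
theorem stmt1 (r : ℝ) (hr : 0 < r)
    (μ : ℝ → ℝ)
    (hμ : ∀ t, μ t = if 0 ≤ t then Real.log (t + Real.exp 1)
      else 1 / Real.log (Real.exp 1 - t)) :
    (∀ t, 0 < μ t) ∧ StrictMono μ ∧ μ 0 = 1 ∧
      Tendsto μ atTop atTop ∧ Tendsto μ atBot (nhds 0) ∧
      Differentiable ℝ μ ∧
      ∀ s : ℝ, μ (s + r) / μ s ≤ (Real.log (Real.exp 1 + r / 2)) ^ 2 := by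
  have he := Real.exp_pos 1
  have hp : ∀ t, 0 ≤ t → μ t = Real.log (t + Real.exp 1) := fun t ht => by
    rw [hμ, if_pos ht]
  have hn : ∀ t, t ≤ 0 → μ t = 1 / Real.log (-t + Real.exp 1) := fun t ht => by
    rcases ht.lt_or_eq with h | h
    · rw [hμ, if_neg (not_le.2 h)]; congr 2; ring
    · subst h; rw [hp 0 le_rfl]; simp
  have hpos : ∀ t, 0 < μ t := fun t => by
    rcases le_total 0 t with h | h
    · rw [hp t h]; linarith [aux_one_le t h]
    · rw [hn t h]; have := aux_one_le (-t) (by linarith); positivity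
  have hL : Tendsto (fun t : ℝ => Real.log (t + Real.exp 1)) atTop atTop :=
    Real.tendsto_log_atTop.comp (tendsto_atTop_add_const_right _ _ tendsto_id)
  refine ⟨hpos, ?_, ?_, ?_, ?_, ?_, ?_⟩
  · apply StrictMonoOn.Iic_union_Ici (a := 0)
    · intro x hx y hy h
      simp only [Set.mem_Iic] at hx hy
      rw [hn x hx, hn y hy]
      have := aux_one_le (-y) (by linarith)
      exact one_div_lt_one_div_of_lt (by linarith) (aux_lt _ _ (by linarith) (by linarith))
    · intro x hx y hy h
      simp only [Set.mem_Ici] at hx hy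
      rw [hp x hx, hp y hy]
      exact aux_lt _ _ hx h
  · rw [hp 0 le_rfl]; simp
  · refine hL.congr' ?_
    filter_upwards [eventually_ge_atTop 0] with t ht using (hp t ht).symm
  · have := (hL.comp tendsto_neg_atBot_atTop).inv_tendsto_atTop
    refine this.congr' ?_
    filter_upwards [eventually_le_atBot 0] with t ht
    rw [hn t ht]; simp
  · have dp : ∀ t, 0 ≤ t → HasDerivAt (fun t : ℝ => Real.log (t + Real.exp 1))
        (1 / (t + Real.exp 1)) t := fun t ht =>
      ((hasDerivAt_id t).add_const _).log (by simp only [id]; positivity)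
    have dn : ∀ t, t ≤ 0 → HasDerivAt (fun t : ℝ => 1 / Real.log (-t + Real.exp 1))
        (1 / (-t + Real.exp 1) / Real.log (-t + Real.exp 1) ^ 2) t := fun t ht => by
      have h1 := aux_one_le (-t) (by linarith)
      have := (((hasDerivAt_neg t).add_const (Real.exp 1)).log (by linarith)).inv (by linarith)
      convert! this using 1
      · ext; simp
      · ring
    intro t
    rcases lt_trichotomy t 0 with h | h | h
    · refine ((dn t h.le).congr_of_eventuallyEq ?_).differentiableAt
      filter_upwards [Iio_mem_nhds h] with x hx using hn x (le_of_lt hx)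
    · subst h
      have a := (dp 0 le_rfl).hasDerivWithinAt (s := Set.Ici 0)
      have b := (dn 0 le_rfl).hasDerivWithinAt (s := Set.Iic 0)
      have a' := a.congr (f₁ := μ) (fun x hx => hp x hx) (hp 0 le_rfl)
      have b' := b.congr (f₁ := μ) (fun x hx => hn x hx) (hn 0 le_rfl)
      simp only [neg_zero, zero_add, Real.log_exp, one_pow, div_one] at a' b'
      have c := b'.union a'
      rw [Set.Iic_union_Ici, hasDerivWithinAt_univ] at c
      exact c.differentiableAt
    · refine ((dp t h.le).congr_of_eventuallyEq ?_).differentiableAt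
      filter_upwards [Ioi_mem_nhds h] with x hx using hp x (le_of_lt hx)
  · intro s
    have h0 := aux_amgm 0 r le_rfl hr.le
    simp only [zero_add, Real.log_exp, one_mul] at h0
    rw [div_le_iff₀ (hpos s)]
    rcases le_total 0 s with h | h
    · rw [hp s h, hp _ (by linarith)]
      have h1 := aux_one_le s h
      have := aux_mul s r h hr.le
      nlinarith
    · have h1 := aux_one_le (-s) (by linarith)
      rcases le_total 0 (s + r) with h' | h'
      · rw [hn s h, hp _ h', mul_one_div, le_div_iff₀ (by linarith)]
        have := aux_amgm (s + r) (-s) h' (by linarith)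
        rwa [show s + r + -s = r by ring] at this
      · rw [hn s h, hn _ h', mul_one_div, le_div_iff₀ (by linarith)]
        have h2 := aux_one_le (-(s + r)) (by linarith)
        have := aux_mul (-(s + r)) r (by linarith) hr.le
        rw [show -(s + r) + r = -s by ring] at this
        rw [one_div_mul_eq_div, div_le_iff₀ (by linarith)]
        nlinarith
end

section
/- In the operator setting below, assume: (iv) ‖T̄(t,σ) ∘ Q(σ)‖ ≤ K (μ(t)/μ(σ))^{β} μ(σ)^{sgn(σ)ν} for all t ≤ σ; the bounded-growth estimate ‖T₀(t,s)‖ ≤ K̃ (μ(t)/μ(s))^{a} μ(s)^{sgn(s)ε} for t ≥ s; and the cocycle identity T̄(t,s) ∘ T̄(s,s+r) ∘ Q(s+r) = T̄(t,s+r) ∘ Q(s+r) for t ≤ s. Then for all t ≤ s, ‖T̄(t,s) ∘ Q₀(s)‖ ≤ K K̃ N^{|a−β|+ν} (μ(t)/μ(s))^{β} μ(s)^{sgn(s)(ν+ε)}. -/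
open Filter MeasureTheory

/-- bound for `‖T̄(t,s) ∘ Q₀(s)‖` for `t ≤ s`, where
`Q₀(s) = T̄(s,s+r) ∘ Q(s+r) ∘ T₀(s+r,s) ∘ X₀` (the latter composition being realized
in `C` by the operator `W s` with `J ∘ W s = T₀(s+r,s) ∘ X₀`, `J : C → C₀` the
isometric embedding). -/
theorem stmt3 {n : ℕ}
    {C : Type*} [NormedAddCommGroup C] [NormedSpace ℝ C] [CompleteSpace C]
    {C₀ : Type*} [NormedAddCommGroup C₀] [NormedSpace ℝ C₀] [CompleteSpace C₀]
    (r : ℝ) (hr : 0 < r)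
    (μ : ℝ → ℝ)
    (hμpos : ∀ t, 0 < μ t) (hμmono : StrictMono μ) (hμ0 : μ 0 = 1)
    (hμtop : Tendsto μ atTop atTop) (hμbot : Tendsto μ atBot (nhds 0))
    (hμdiff : Differentiable ℝ μ)
    (N : ℝ) (hN : 1 < N) (hH : ∀ s : ℝ, μ (s + r) / μ s ≤ N)
    (K Kt α β θ ν a ε : ℝ)
    (hK : 1 ≤ K) (hKt : 1 ≤ Kt) (hα : 0 < α) (hβ : 0 < β)
    (hθ : 0 ≤ θ) (hν : 0 ≤ ν) (ha : 0 ≤ a) (hε : 0 ≤ ε)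
    (J : C →L[ℝ] C₀) (hJ : ∀ x, ‖J x‖ = ‖x‖)
    (X₀ : (Fin n → ℝ) →L[ℝ] C₀) (hX₀ : ‖X₀‖ ≤ 1)
    (T₀ : ℝ → ℝ → C₀ →L[ℝ] C₀)
    (P : ℝ → C →L[ℝ] C) (Q : ℝ → C →L[ℝ] C)
    (hPQ : ∀ s, Q s = ContinuousLinearMap.id ℝ C - P s)
    (Tb : ℝ → ℝ → C →L[ℝ] C)
    -- (iv): dichotomy bound on the unstable part
    (hiv : ∀ t σ : ℝ, t ≤ σ →
      ‖(Tb t σ).comp (Q σ)‖ ≤ K * (μ t / μ σ) ^ β * μ σ ^ (Real.sign σ * ν))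
    -- bounded growth of `T₀`
    (hBG : ∀ s t : ℝ, s ≤ t →
      ‖T₀ t s‖ ≤ Kt * (μ t / μ s) ^ a * μ s ^ (Real.sign s * ε))
    -- cocycle identity
    (hcoc : ∀ t s : ℝ, t ≤ s →
      (Tb t s).comp ((Tb s (s + r)).comp (Q (s + r))) = (Tb t (s + r)).comp (Q (s + r)))
    -- `W s` realizes `T₀(s+r,s) ∘ X₀` inside `C`
    (W : ℝ → (Fin n → ℝ) →L[ℝ] C)
    (hW : ∀ s : ℝ, J.comp (W s) = (T₀ (s + r) s).comp X₀) :
    ∀ t s : ℝ, t ≤ s →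
      ‖(Tb t s).comp ((Tb s (s + r)).comp ((Q (s + r)).comp (W s)))‖ ≤
        K * Kt * N ^ (|a - β| + ν) * (μ t / μ s) ^ β * μ s ^ (Real.sign s * (ν + ε)) := by
  intro t s hts
  have hx := hμpos s
  have hy := hμpos (s + r)
  have ht := hμpos t
  have hxy : μ s < μ (s + r) := hμmono (by linarith)
  have hyN : μ (s + r) ≤ N * μ s := (div_le_iff₀ hx).1 (hH s)
  have hN0 : 0 < N := by linarith
  have hWn : ‖W s‖ ≤ ‖T₀ (s + r) s‖ := by
    refine ContinuousLinearMap.opNorm_le_bound _ (norm_nonneg _) fun v => ?_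
    rw [← hJ]
    have h1 : J (W s v) = T₀ (s + r) s (X₀ v) := congrArg (fun L => L v) (hW s)
    rw [h1]
    refine (ContinuousLinearMap.le_opNorm _ _).trans ?_
    refine mul_le_mul_of_nonneg_left ?_ (norm_nonneg _)
    have := X₀.le_opNorm v
    nlinarith [norm_nonneg v]
  have hsign : μ (s + r) ^ Real.sign (s + r) ≤ N * μ s ^ Real.sign s := by
    rcases lt_trichotomy s 0 with h | h | h
    · have hx1 : μ s < 1 := hμ0 ▸ hμmono h
      rw [Real.sign_of_neg h, Real.rpow_neg_one]
      have hinv : 1 < (μ s)⁻¹ := (one_lt_inv₀ hx).2 hx1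
      rcases lt_trichotomy (s + r) 0 with h' | h' | h'
      · rw [Real.sign_of_neg h', Real.rpow_neg_one]
        have : (μ (s + r))⁻¹ ≤ (μ s)⁻¹ := inv_anti₀ hx hxy.le
        nlinarith
      · rw [h', Real.sign_zero, Real.rpow_zero]
        nlinarith
      · rw [Real.sign_of_pos h', Real.rpow_one]
        nlinarith
    · subst h
      rw [Real.sign_zero, Real.rpow_zero, Real.sign_of_pos (by linarith), Real.rpow_one]
      rw [hμ0] at hyN
      exact hyN
    · rw [Real.sign_of_pos h, Real.sign_of_pos (by linarith), Real.rpow_one, Real.rpow_one]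
      exact hyN
  have h2 : μ (s + r) ^ (Real.sign (s + r) * ν) ≤ N ^ ν * μ s ^ (Real.sign s * ν) := by
    rw [Real.rpow_mul hy.le, Real.rpow_mul hx.le, ← Real.mul_rpow hN0.le (by positivity)]
    exact Real.rpow_le_rpow (by positivity) hsign hν
  have h3 : (μ t / μ (s + r)) ^ β * (μ (s + r) / μ s) ^ a
      ≤ N ^ |a - β| * (μ t / μ s) ^ β := by
    have hq : 1 ≤ μ (s + r) / μ s := (one_le_div hx).2 hxy.le
    have hq0 : 0 < μ (s + r) / μ s := by positivity
    have e1 : μ t / μ s = (μ t / μ (s + r)) * (μ (s + r) / μ s) := by field_simp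
    have e2 : (μ (s + r) / μ s) ^ a
        = (μ (s + r) / μ s) ^ (a - β) * (μ (s + r) / μ s) ^ β := by
      rw [← Real.rpow_add hq0]; congr 1; ring
    have e3 : (μ (s + r) / μ s) ^ (a - β) ≤ N ^ |a - β| :=
      (Real.rpow_le_rpow_of_exponent_le hq (le_abs_self _)).trans
        (Real.rpow_le_rpow hq0.le (hH s) (abs_nonneg _))
    rw [e1, Real.mul_rpow (by positivity) hq0.le, e2]
    calc _ = (μ (s + r) / μ s) ^ (a - β)
          * ((μ t / μ (s + r)) ^ β * (μ (s + r) / μ s) ^ β) := by ring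
      _ ≤ _ := mul_le_mul_of_nonneg_right e3 (by positivity)
  have hop : (Tb t s).comp ((Tb s (s + r)).comp ((Q (s + r)).comp (W s)))
      = ((Tb t (s + r)).comp (Q (s + r))).comp (W s) := by
    rw [← hcoc t s hts]; rfl
  rw [hop]
  have hA := hiv t (s + r) (by linarith)
  have hB := hWn.trans (hBG s (s + r) (by linarith))
  have hK0 : 0 ≤ K := by linarith
  have hKt0 : 0 ≤ Kt := by linarith
  refine (ContinuousLinearMap.opNorm_comp_le _ _).trans ?_
  refine (mul_le_mul hA hB (norm_nonneg _) (by positivity)).trans ?_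
  rw [Real.rpow_add hN0, mul_add, Real.rpow_add hx]
  calc _ = (K * Kt * μ s ^ (Real.sign s * ε))
        * (((μ t / μ (s + r)) ^ β * (μ (s + r) / μ s) ^ a)
          * μ (s + r) ^ (Real.sign (s + r) * ν)) := by ring
    _ ≤ (K * Kt * μ s ^ (Real.sign s * ε))
        * ((N ^ |a - β| * (μ t / μ s) ^ β) * (N ^ ν * μ s ^ (Real.sign s * ν))) :=
      mul_le_mul_of_nonneg_left (mul_le_mul h3 h2 (by positivity) (by positivity))
        (by positivity)
    _ = _ := by ring
end

section
/- In the operator setting below, assume: ‖T₀(t,s)‖ ≤ K̃ (μ(t)/μ(s))^{a} μ(s)^{sgn(s)ε} for t ≥ s; ‖Q₀(s)‖ ≤ K₁ μ(s)^{sgn(s)(ν+ε)} for all s, where K₁ := K K̃ N^{|a−β|+ν}; and θ ≥ ε + ν. Then for every s ∈ ℝ and every t ∈ [s, s+r], ‖T₀(t,s) ∘ P₀(s)‖ ≤ K̃ N^{a} (1 + K₁) μ(s)^{sgn(s)(θ+ε)}. -/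
open Filter MeasureTheory

/-- for `t ∈ [s, s+r]`, the bound
`‖T₀(t,s) ∘ P₀(s)‖ ≤ K̃ N^a (1 + K₁) μ(s)^{sgn(s)(θ+ε)}` holds, where
`P₀(s) = X₀ − J ∘ Q₀(s)` and `K₁ = K K̃ N^{|a−β|+ν}`. -/
theorem stmt4 {n : ℕ}
    {C : Type*} [NormedAddCommGroup C] [NormedSpace ℝ C] [CompleteSpace C]
    {C₀ : Type*} [NormedAddCommGroup C₀] [NormedSpace ℝ C₀] [CompleteSpace C₀]
    (r : ℝ) (hr : 0 < r)
    (μ : ℝ → ℝ)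
    (hμpos : ∀ t, 0 < μ t) (hμmono : StrictMono μ) (hμ0 : μ 0 = 1)
    (hμtop : Tendsto μ atTop atTop) (hμbot : Tendsto μ atBot (nhds 0))
    (hμdiff : Differentiable ℝ μ)
    (N : ℝ) (hN : 1 < N) (hH : ∀ s : ℝ, μ (s + r) / μ s ≤ N)
    (K Kt α β θ ν a ε : ℝ)
    (hK : 1 ≤ K) (hKt : 1 ≤ Kt) (hα : 0 < α) (hβ : 0 < β)
    (hθ : 0 ≤ θ) (hν : 0 ≤ ν) (ha : 0 ≤ a) (hε : 0 ≤ ε)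
    (J : C →L[ℝ] C₀) (hJ : ∀ x, ‖J x‖ = ‖x‖)
    (X₀ : (Fin n → ℝ) →L[ℝ] C₀) (hX₀ : ‖X₀‖ ≤ 1)
    (T₀ : ℝ → ℝ → C₀ →L[ℝ] C₀)
    -- bounded growth of `T₀`
    (hBG : ∀ s t : ℝ, s ≤ t →
      ‖T₀ t s‖ ≤ Kt * (μ t / μ s) ^ a * μ s ^ (Real.sign s * ε))
    (Q₀ : ℝ → (Fin n → ℝ) →L[ℝ] C)
    -- bound on `Q₀`, with `K₁ = K K̃ N^{|a−β|+ν}`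
    (hQ₀ : ∀ s : ℝ, ‖Q₀ s‖ ≤
      K * Kt * N ^ (|a - β| + ν) * μ s ^ (Real.sign s * (ν + ε)))
    -- parameter condition θ ≥ ε + ν
    (hθεν : ε + ν ≤ θ) :
    ∀ s t : ℝ, s ≤ t → t ≤ s + r →
      ‖(T₀ t s).comp (X₀ - J.comp (Q₀ s))‖ ≤
        Kt * N ^ a * (1 + K * Kt * N ^ (|a - β| + ν)) * μ s ^ (Real.sign s * (θ + ε)) := by
  intro s t hst htr
  have hm : ∀ x y : ℝ, x ≤ y → μ s ^ (Real.sign s * x) ≤ μ s ^ (Real.sign s * y) := by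
    intro x y hxy
    rcases lt_trichotomy s 0 with h | h | h
    · rw [Real.sign_of_neg h]
      have h1 : μ s ≤ 1 := hμ0 ▸ (hμmono h).le
      exact Real.rpow_le_rpow_of_exponent_ge (hμpos s) h1 (by linarith)
    · subst h
      simp
    · rw [Real.sign_of_pos h]
      have h1 : 1 ≤ μ s := hμ0 ▸ (hμmono h).le
      exact Real.rpow_le_rpow_of_exponent_le h1 (by linarith)
  have hs := hμpos s
  have hN0 : 0 < N := by linarith
  have hK0 : 0 < K := by linarith
  have hKt0 : 0 < Kt := by linarith
  have hm1 : 1 ≤ μ s ^ (Real.sign s * θ) := by simpa using hm 0 θ hθ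
  have hm2 : μ s ^ (Real.sign s * (ν + ε)) ≤ μ s ^ (Real.sign s * θ) := hm _ _ (by linarith)
  have hadd : μ s ^ (Real.sign s * (θ + ε))
      = μ s ^ (Real.sign s * ε) * μ s ^ (Real.sign s * θ) := by
    rw [← Real.rpow_add hs]
    congr 1
    ring
  have hK1 : 0 < K * Kt * N ^ (|a - β| + ν) := by positivity
  have hJn : ‖J.comp (Q₀ s)‖ ≤ ‖Q₀ s‖ := by
    refine ContinuousLinearMap.opNorm_le_bound _ (norm_nonneg _) fun x => ?_
    rw [ContinuousLinearMap.comp_apply, hJ]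
    exact (Q₀ s).le_opNorm x
  have hQ := hQ₀ s
  have hP : ‖X₀ - J.comp (Q₀ s)‖
      ≤ (1 + K * Kt * N ^ (|a - β| + ν)) * μ s ^ (Real.sign s * θ) := by
    have h1 := norm_sub_le X₀ (J.comp (Q₀ s))
    have h2 := mul_le_mul_of_nonneg_left hm2 hK1.le
    linarith
  have hT : ‖T₀ t s‖ ≤ Kt * N ^ a * μ s ^ (Real.sign s * ε) := by
    refine (hBG s t hst).trans ?_
    have h1 : μ t / μ s ≤ N :=
      (div_le_div_of_nonneg_right (hμmono.monotone htr) hs.le).trans (hH s)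
    have h2 : (μ t / μ s) ^ a ≤ N ^ a :=
      Real.rpow_le_rpow (div_pos (hμpos t) hs).le h1 ha
    gcongr
  calc ‖(T₀ t s).comp (X₀ - J.comp (Q₀ s))‖ ≤ ‖T₀ t s‖ * ‖X₀ - J.comp (Q₀ s)‖ :=
        ContinuousLinearMap.opNorm_comp_le _ _
    _ ≤ (Kt * N ^ a * μ s ^ (Real.sign s * ε)) *
        ((1 + K * Kt * N ^ (|a - β| + ν)) * μ s ^ (Real.sign s * θ)) :=
        mul_le_mul hT hP (norm_nonneg _) (by positivity)
    _ = _ := by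
        rw [hadd]
        ring
end

section
/- In the operator setting below, assume: (iii) ‖T(t,σ) ∘ P(σ)‖ ≤ K (μ(t)/μ(σ))^{−α} μ(σ)^{sgn(σ)θ} for t ≥ σ; there are bounded linear operators W(s) : ℝⁿ → C with ‖W(s)‖ ≤ K̃ (μ(s+r)/μ(s))^{a} μ(s)^{sgn(s)ε} such that T₀(t,s) ∘ P₀(s) = J ∘ T(t,s+r) ∘ P(s+r) ∘ W(s) for all t ≥ s + r; and θ ≥ ε + ν. Then for all t ≥ s + r, ‖T₀(t,s) ∘ P₀(s)‖ ≤ K K̃ N^{a+α+θ} (μ(t)/μ(s))^{−α} μ(s)^{sgn(s)(θ+ε)}. -/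
open Filter MeasureTheory

/-- for `t ≥ s + r`, the bound
`‖T₀(t,s) ∘ P₀(s)‖ ≤ K K̃ N^{a+α+θ} (μ(t)/μ(s))^{−α} μ(s)^{sgn(s)(θ+ε)}` holds,
given (iii), the representation `T₀(t,s) ∘ P₀(s) = J ∘ T(t,s+r) ∘ P(s+r) ∘ W(s)`
with `‖W(s)‖ ≤ K̃ (μ(s+r)/μ(s))^a μ(s)^{sgn(s)ε}`, and `θ ≥ ε + ν`. -/
theorem stmt5 {n : ℕ}
    {C : Type*} [NormedAddCommGroup C] [NormedSpace ℝ C] [CompleteSpace C]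
    {C₀ : Type*} [NormedAddCommGroup C₀] [NormedSpace ℝ C₀] [CompleteSpace C₀]
    (r : ℝ) (hr : 0 < r)
    (μ : ℝ → ℝ)
    (hμpos : ∀ t, 0 < μ t) (hμmono : StrictMono μ) (hμ0 : μ 0 = 1)
    (hμtop : Tendsto μ atTop atTop) (hμbot : Tendsto μ atBot (nhds 0))
    (hμdiff : Differentiable ℝ μ)
    (N : ℝ) (hN : 1 < N) (hH : ∀ s : ℝ, μ (s + r) / μ s ≤ N)
    (K Kt α β θ ν a ε : ℝ)
    (hK : 1 ≤ K) (hKt : 1 ≤ Kt) (hα : 0 < α) (hβ : 0 < β)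
    (hθ : 0 ≤ θ) (hν : 0 ≤ ν) (ha : 0 ≤ a) (hε : 0 ≤ ε)
    (J : C →L[ℝ] C₀) (hJ : ∀ x, ‖J x‖ = ‖x‖)
    (X₀ : (Fin n → ℝ) →L[ℝ] C₀) (hX₀ : ‖X₀‖ ≤ 1)
    (T : ℝ → ℝ → C →L[ℝ] C) (T₀ : ℝ → ℝ → C₀ →L[ℝ] C₀)
    (P : ℝ → C →L[ℝ] C)
    -- (iii): dichotomy bound on the stable part
    (hiii : ∀ σ t : ℝ, σ ≤ t →
      ‖(T t σ).comp (P σ)‖ ≤ K * (μ t / μ σ) ^ (-α) * μ σ ^ (Real.sign σ * θ))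
    (P₀ : ℝ → (Fin n → ℝ) →L[ℝ] C₀)
    (W : ℝ → (Fin n → ℝ) →L[ℝ] C)
    (hW : ∀ s : ℝ, ‖W s‖ ≤ Kt * (μ (s + r) / μ s) ^ a * μ s ^ (Real.sign s * ε))
    -- representation of `T₀(t,s) ∘ P₀(s)` for `t ≥ s + r`
    (hrep : ∀ s t : ℝ, s + r ≤ t →
      (T₀ t s).comp (P₀ s) = J.comp (((T t (s + r)).comp (P (s + r))).comp (W s)))
    -- parameter condition θ ≥ ε + ν
    (hθεν : ε + ν ≤ θ) :
    ∀ s t : ℝ, s + r ≤ t →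
      ‖(T₀ t s).comp (P₀ s)‖ ≤
        K * Kt * N ^ (a + α + θ) * (μ t / μ s) ^ (-α) * μ s ^ (Real.sign s * (θ + ε)) := by
  intro s t hst
  have key : ∀ u x : ℝ, μ u ^ (Real.sign u * x) = Real.exp (x * |Real.log (μ u)|) := by
    intro u x
    rw [Real.rpow_def_of_pos (hμpos u)]
    congr 1
    rcases lt_trichotomy u 0 with h | h | h
    · have h1 : μ u < 1 := hμ0 ▸ hμmono h
      rw [Real.sign_of_neg h, abs_of_neg (Real.log_neg (hμpos u) h1)]
      ring
    · subst h
      simp [hμ0]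
    · have h1 : 1 < μ u := hμ0 ▸ hμmono h
      rw [Real.sign_of_pos h, abs_of_pos (Real.log_pos h1)]
      ring
  have hN0 : 0 < N := by linarith
  have hs := hμpos s
  have hsr := hμpos (s + r)
  have ht := hμpos t
  have hq : 0 < μ (s + r) / μ s := div_pos hsr hs
  have hlogN : Real.log (μ (s + r)) - Real.log (μ s) ≤ Real.log N := by
    rw [← Real.log_div hsr.ne' hs.ne']
    exact Real.log_le_log hq (hH s)
  have hlog0 : Real.log (μ s) ≤ Real.log (μ (s + r)) :=
    Real.log_le_log hs (hμmono (by linarith)).le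
  have habs : |Real.log (μ (s + r))| ≤ Real.log N + |Real.log (μ s)| := by
    have h1 := abs_sub_abs_le_abs_sub (Real.log (μ (s + r))) (Real.log (μ s))
    rw [abs_of_nonneg (sub_nonneg.2 hlog0)] at h1
    linarith
  have hnorm : ‖(T₀ t s).comp (P₀ s)‖ ≤ ‖(T t (s + r)).comp (P (s + r))‖ * ‖W s‖ := by
    rw [hrep s t hst]
    refine ContinuousLinearMap.opNorm_le_bound _ (by positivity) fun x => ?_
    rw [ContinuousLinearMap.comp_apply, hJ]
    exact (ContinuousLinearMap.le_opNorm _ x).trans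
      (mul_le_mul_of_nonneg_right (ContinuousLinearMap.opNorm_comp_le _ _) (norm_nonneg x))
  have h1 := hiii (s + r) t hst
  have h2 := hW s
  refine hnorm.trans ((mul_le_mul h1 h2 (norm_nonneg _) ((norm_nonneg _).trans h1)).trans ?_)
  rw [key, key, key, Real.rpow_def_of_pos (div_pos ht hsr), Real.rpow_def_of_pos hq,
    Real.rpow_def_of_pos hN0, Real.rpow_def_of_pos (div_pos ht hs),
    Real.log_div ht.ne' hsr.ne', Real.log_div hsr.ne' hs.ne', Real.log_div ht.ne' hs.ne']
  generalize Real.log (μ (s + r)) = y at *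
  generalize Real.log (μ s) = x at *
  generalize Real.log (μ t) = z at *
  generalize Real.log N = L at *
  have hexp : Real.exp ((z - y) * -α + θ * |y| + ((y - x) * a + ε * |x|))
      ≤ Real.exp (L * (a + α + θ) + (z - x) * -α + (θ + ε) * |x|) := by
    apply Real.exp_le_exp.2
    have e1 := mul_le_mul_of_nonneg_left habs hθ
    have e2 := mul_le_mul_of_nonneg_left hlogN ha
    have e3 := mul_le_mul_of_nonneg_left hlogN hα.le
    linarith
  simp only [Real.exp_add] at hexp
  have h3 := mul_le_mul_of_nonneg_left hexp (show 0 ≤ K * Kt by nlinarith)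
  linarith
end

section
/- (Main Lemma.) In the operator setting below, assume the nonuniform μ-dichotomy bounds (iii) ‖T(t,s) ∘ P(s)‖ ≤ K (μ(t)/μ(s))^{−α} μ(s)^{sgn(s)θ} for t ≥ s and (iv) ‖T̄(t,s) ∘ Q(s)‖ ≤ K (μ(t)/μ(s))^{β} μ(s)^{sgn(s)ν} for t ≤ s; the bounded-growth estimate ‖T₀(t,s)‖ ≤ K̃ (μ(t)/μ(s))^{a} μ(s)^{sgn(s)ε} for t ≥ s; the cocycle identity T̄(t,s) ∘ T̄(s,s+r) ∘ Q(s+r) = T̄(t,s+r) ∘ Q(s+r) for t ≤ s; the representation T₀(t,s) ∘ P₀(s) = J ∘ T(t,s+r) ∘ P(s+r) ∘ W(s) for t ≥ s + r, where W(s) : ℝⁿ → C satisfies J ∘ W(s) = T₀(s+r,s) ∘ X₀; and the parameter conditions θ ≥ ε + ν, α > θ + ε, β > ν + ε. Then there exists a constant D > 0 such that ‖T₀(t,s) ∘ P₀(s)‖ ≤ D (μ(t)/μ(s))^{−α} μ(s)^{sgn(s)(θ+ε)} for all t ≥ s, and ‖T̄(t,s) ∘ Q₀(s)‖ ≤ D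 (μ(t)/μ(s))^{β} μ(s)^{sgn(s)(ν+ε)} for all t ≤ s. -/
open Filter MeasureTheory

/-- Main Lemma: under the nonuniform μ-dichotomy bounds (iii)-(iv),
bounded growth of `T₀`, the cocycle identity, the representation of
`T₀(t,s) ∘ P₀(s)` for `t ≥ s+r`, and the parameter conditions
`θ ≥ ε+ν`, `α > θ+ε`, `β > ν+ε`, there is `D > 0` with
`‖T₀(t,s)∘P₀(s)‖ ≤ D (μ(t)/μ(s))^{−α} μ(s)^{sgn(s)(θ+ε)}` for `t ≥ s` and
`‖T̄(t,s)∘Q₀(s)‖ ≤ D (μ(t)/μ(s))^{β} μ(s)^{sgn(s)(ν+ε)}` for `t ≤ s`.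
Here `Q₀(s) = T̄(s,s+r)∘Q(s+r)∘W(s)` with `J∘W(s) = T₀(s+r,s)∘X₀` and
`P₀(s) = X₀ − J∘Q₀(s)`. -/
theorem stmt6 {n : ℕ}
    {C : Type*} [NormedAddCommGroup C] [NormedSpace ℝ C] [CompleteSpace C]
    {C₀ : Type*} [NormedAddCommGroup C₀] [NormedSpace ℝ C₀] [CompleteSpace C₀]
    (r : ℝ) (hr : 0 < r)
    (μ : ℝ → ℝ)
    (hμpos : ∀ t, 0 < μ t) (hμmono : StrictMono μ) (hμ0 : μ 0 = 1)
    (hμtop : Tendsto μ atTop atTop) (hμbot : Tendsto μ atBot (nhds 0))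
    (hμdiff : Differentiable ℝ μ)
    (N : ℝ) (hN : 1 < N) (hH : ∀ s : ℝ, μ (s + r) / μ s ≤ N)
    (K Kt α β θ ν a ε : ℝ)
    (hK : 1 ≤ K) (hKt : 1 ≤ Kt) (hα : 0 < α) (hβ : 0 < β)
    (hθ : 0 ≤ θ) (hν : 0 ≤ ν) (ha : 0 ≤ a) (hε : 0 ≤ ε)
    (J : C →L[ℝ] C₀) (hJ : ∀ x, ‖J x‖ = ‖x‖)
    (X₀ : (Fin n → ℝ) →L[ℝ] C₀) (hX₀ : ‖X₀‖ ≤ 1)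
    (T : ℝ → ℝ → C →L[ℝ] C) (T₀ : ℝ → ℝ → C₀ →L[ℝ] C₀)
    (P : ℝ → C →L[ℝ] C) (Q : ℝ → C →L[ℝ] C)
    (hPQ : ∀ s, Q s = ContinuousLinearMap.id ℝ C - P s)
    (Tb : ℝ → ℝ → C →L[ℝ] C)
    -- (iii): dichotomy bound on the stable part
    (hiii : ∀ s t : ℝ, s ≤ t →
      ‖(T t s).comp (P s)‖ ≤ K * (μ t / μ s) ^ (-α) * μ s ^ (Real.sign s * θ))
    -- (iv): dichotomy bound on the unstable part
    (hiv : ∀ t s : ℝ, t ≤ s →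
      ‖(Tb t s).comp (Q s)‖ ≤ K * (μ t / μ s) ^ β * μ s ^ (Real.sign s * ν))
    -- bounded growth of `T₀`
    (hBG : ∀ s t : ℝ, s ≤ t →
      ‖T₀ t s‖ ≤ Kt * (μ t / μ s) ^ a * μ s ^ (Real.sign s * ε))
    -- cocycle identity
    (hcoc : ∀ t s : ℝ, t ≤ s →
      (Tb t s).comp ((Tb s (s + r)).comp (Q (s + r))) = (Tb t (s + r)).comp (Q (s + r)))
    -- `W s` realizes `T₀(s+r,s) ∘ X₀` inside `C`
    (W : ℝ → (Fin n → ℝ) →L[ℝ] C)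
    (hW : ∀ s : ℝ, J.comp (W s) = (T₀ (s + r) s).comp X₀)
    -- representation of `T₀(t,s) ∘ P₀(s)` for `t ≥ s + r`
    (hrep : ∀ s t : ℝ, s + r ≤ t →
      (T₀ t s).comp (X₀ - J.comp ((Tb s (s + r)).comp ((Q (s + r)).comp (W s)))) =
        J.comp (((T t (s + r)).comp (P (s + r))).comp (W s)))
    -- parameter conditions
    (hθεν : ε + ν ≤ θ) (hαθε : θ + ε < α) (hβνε : ν + ε < β) :
    ∃ D : ℝ, 0 < D ∧
      (∀ s t : ℝ, s ≤ t →
        ‖(T₀ t s).comp (X₀ - J.comp ((Tb s (s + r)).comp ((Q (s + r)).comp (W s))))‖ ≤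
          D * (μ t / μ s) ^ (-α) * μ s ^ (Real.sign s * (θ + ε))) ∧
      (∀ t s : ℝ, t ≤ s →
        ‖(Tb t s).comp ((Tb s (s + r)).comp ((Q (s + r)).comp (W s)))‖ ≤
          D * (μ t / μ s) ^ β * μ s ^ (Real.sign s * (ν + ε))) := by
  have hsucc : ∀ s, s ≤ s + r := fun s => by linarith
  have hN0 : (0:ℝ) < N := by linarith
  -- the weight E
  obtain ⟨E, hE⟩ : ∃ E : ℝ → ℝ, ∀ s, E s = μ s ^ (Real.sign s) := ⟨_, fun _ => rfl⟩
  have hEpow : ∀ s x, μ s ^ (Real.sign s * x) = E s ^ x := by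
    intro s x
    rw [hE, Real.rpow_mul (hμpos s).le]
  have hE1 : ∀ s, 1 ≤ E s := by
    intro s
    rw [hE]
    rcases lt_trichotomy s 0 with h | h | h
    · rw [Real.sign_of_neg h, Real.rpow_neg_one]
      have : μ s < 1 := hμ0 ▸ hμmono h
      exact (one_le_inv₀ (hμpos s)).2 this.le
    · subst h; simp
    · rw [Real.sign_of_pos h, Real.rpow_one]
      exact (hμ0 ▸ hμmono h : (1:ℝ) < μ s).le
  have hstep : ∀ s, μ (s + r) ≤ N * μ s := fun s => (div_le_iff₀ (hμpos s)).1 (hH s)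
  have hEstep : ∀ s, E (s + r) ≤ N * E s := by
    intro s
    have h1 := hE1 s
    have hNE : N ≤ N * E s := by nlinarith
    rcases lt_trichotomy (s + r) 0 with h | h | h
    · have hs : s < 0 := by linarith
      have h2 : E (s + r) ≤ E s := by
        rw [hE, hE, Real.sign_of_neg h, Real.sign_of_neg hs, Real.rpow_neg_one,
          Real.rpow_neg_one]
        exact inv_anti₀ (hμpos s) (hμmono.monotone (hsucc s))
      nlinarith
    · have h2 : E (s + r) = 1 := by rw [hE, h]; simp
      linarith
    · have h2 : E (s + r) = μ (s + r) := by rw [hE, Real.sign_of_pos h, Real.rpow_one]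
      rw [h2]
      refine (hstep s).trans ?_
      rcases lt_trichotomy s 0 with hz | hz | hz
      · have : μ s < 1 := hμ0 ▸ hμmono hz
        nlinarith
      · rw [hz, hμ0, ← hz]; linarith
      · rw [hE, Real.sign_of_pos hz, Real.rpow_one]
  have hE0 : ∀ s, 0 < E s := fun s => lt_of_lt_of_le one_pos (hE1 s)
  have hEs : ∀ s x : ℝ, 0 ≤ x → E (s + r) ^ x ≤ N ^ x * E s ^ x := by
    intro s x hx
    rw [← Real.mul_rpow hN0.le (hE0 s).le]
    exact Real.rpow_le_rpow (hE0 _).le (hEstep s) hx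
  simp only [hEpow] at hiii hiv hBG ⊢
  have hN1 : ∀ x : ℝ, 0 ≤ x → 1 ≤ N ^ x := fun x hx => Real.one_le_rpow hN.le hx
  have hdivpos : ∀ t s, 0 < μ t / μ s := fun t s => div_pos (hμpos t) (hμpos s)
  have hdN : ∀ s t, t ≤ s + r → μ t / μ s ≤ N := fun s t h =>
    (div_le_div_of_nonneg_right (hμmono.monotone h) (hμpos s).le).trans (hH s)
  have hWb : ∀ s, ‖W s‖ ≤ Kt * N ^ a * E s ^ ε := by
    intro s
    have h1 : ‖W s‖ ≤ ‖(T₀ (s + r) s).comp X₀‖ := by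
      refine ContinuousLinearMap.opNorm_le_bound _ (norm_nonneg _) fun x => ?_
      rw [← hJ, ← hW]
      exact (J.comp (W s)).le_opNorm x
    have h2 : ‖(T₀ (s + r) s).comp X₀‖ ≤ ‖T₀ (s + r) s‖ := by
      refine (ContinuousLinearMap.opNorm_comp_le _ _).trans ?_
      exact mul_le_of_le_one_right (norm_nonneg _) hX₀
    refine h1.trans (h2.trans ((hBG s (s + r) (hsucc s)).trans ?_))
    have := Real.rpow_le_rpow (hdivpos _ _).le (hH s) ha
    have := (Real.rpow_pos_of_pos (hE0 s) ε).le
    gcongr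
  -- unstable bound
  have hQb : ∀ t s, t ≤ s → ‖((Tb t (s + r)).comp (Q (s + r))).comp (W s)‖ ≤
      (K * Kt * N ^ ν * N ^ a) * (μ t / μ s) ^ β * E s ^ (ν + ε) := by
    intro t s hts
    refine (ContinuousLinearMap.opNorm_comp_le _ _).trans ?_
    have h1 := hiv t (s + r) (by linarith)
    have h2 : (μ t / μ (s + r)) ^ β ≤ (μ t / μ s) ^ β := by
      refine Real.rpow_le_rpow (hdivpos _ _).le ?_ hβ.le
      exact div_le_div_of_nonneg_left (hμpos t).le (hμpos s) (hμmono.monotone (hsucc s))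
    have h3 := hEs s ν hν
    have p1 := (Real.rpow_pos_of_pos (hdivpos t s) β).le
    have p2 := (Real.rpow_pos_of_pos (hE0 (s + r)) ν).le
    calc ‖(Tb t (s + r)).comp (Q (s + r))‖ * ‖W s‖
        ≤ (K * (μ t / μ s) ^ β * (N ^ ν * E s ^ ν)) * (Kt * N ^ a * E s ^ ε) := by
          refine mul_le_mul (h1.trans ?_) (hWb s) (norm_nonneg _) (by have := hE0 s; positivity)
          gcongr
      _ = _ := by rw [Real.rpow_add (hE0 s)]; ring
  have hD1 : 0 < K * Kt * N ^ ν * N ^ a := by positivity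
  have hD2 : 0 < K * N ^ α * N ^ θ * Kt * N ^ a := by positivity
  have hD3 : 0 < Kt * N ^ a * (1 + K * Kt * N ^ ν * N ^ a) * N ^ α := by positivity
  have hfin : ∀ (d D x y A : ℝ), d ≤ D → 0 < x → 0 < y → A ≤ d * x * y → A ≤ D * x * y := by
    intro d D x y A h hx hy hA
    refine hA.trans ?_
    gcongr
  refine ⟨K * Kt * N ^ ν * N ^ a + K * N ^ α * N ^ θ * Kt * N ^ a +
    Kt * N ^ a * (1 + K * Kt * N ^ ν * N ^ a) * N ^ α, by linarith, ?_, ?_⟩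
  · intro s t hst
    rcases le_total (s + r) t with h | h
    · refine hfin (K * N ^ α * N ^ θ * Kt * N ^ a) _ _ _ _ (by linarith)
        (Real.rpow_pos_of_pos (hdivpos _ _) _) (Real.rpow_pos_of_pos (hE0 _) _) ?_
      rw [hrep s t h]
      have h0 : ‖J.comp (((T t (s + r)).comp (P (s + r))).comp (W s))‖ ≤
          ‖((T t (s + r)).comp (P (s + r))).comp (W s)‖ := by
        refine ContinuousLinearMap.opNorm_le_bound _ (norm_nonneg _) fun x => ?_
        rw [ContinuousLinearMap.comp_apply, hJ]
        exact ContinuousLinearMap.le_opNorm _ x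
      refine h0.trans ((ContinuousLinearMap.opNorm_comp_le _ _).trans ?_)
      have h1 := hiii (s + r) t h
      have h2 : (μ t / μ (s + r)) ^ (-α) ≤ N ^ α * (μ t / μ s) ^ (-α) := by
        have e : μ t / μ (s + r) = (μ t / μ s) / (μ (s + r) / μ s) := by
          have := (hμpos s).ne'
          have := (hμpos (s + r)).ne'
          field_simp
        rw [e, Real.div_rpow (hdivpos _ _).le (hdivpos _ _).le,
          Real.rpow_neg (hdivpos (s + r) s).le, div_inv_eq_mul, mul_comm]
        have := Real.rpow_le_rpow (hdivpos (s + r) s).le (hH s) hα.le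
        exact mul_le_mul_of_nonneg_right this (Real.rpow_pos_of_pos (hdivpos _ _) _).le
      have h3 := hEs s θ hθ
      have p1 := Real.rpow_pos_of_pos (hdivpos t s) (-α)
      have p2 := (Real.rpow_pos_of_pos (hE0 (s + r)) θ).le
      calc ‖(T t (s + r)).comp (P (s + r))‖ * ‖W s‖
          ≤ (K * (N ^ α * (μ t / μ s) ^ (-α)) * (N ^ θ * E s ^ θ)) * (Kt * N ^ a * E s ^ ε) := by
            refine mul_le_mul (h1.trans ?_) (hWb s) (norm_nonneg _) (by have := hE0 s; positivity)
            gcongr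
        _ = _ := by rw [Real.rpow_add (hE0 s)]; ring
    · refine hfin (Kt * N ^ a * (1 + K * Kt * N ^ ν * N ^ a) * N ^ α) _ _ _ _ (by linarith)
        (Real.rpow_pos_of_pos (hdivpos _ _) _) (Real.rpow_pos_of_pos (hE0 _) _) ?_
      refine (ContinuousLinearMap.opNorm_comp_le _ _).trans ?_
      have hT : ‖T₀ t s‖ ≤ Kt * N ^ a * E s ^ ε := by
        refine (hBG s t hst).trans ?_
        have := Real.rpow_le_rpow (hdivpos _ _).le (hdN s t h) ha
        have := (Real.rpow_pos_of_pos (hE0 s) ε).le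
        gcongr
      have hq := hQb s s le_rfl
      rw [div_self (hμpos s).ne', Real.one_rpow, mul_one, ContinuousLinearMap.comp_assoc] at hq
      have hEv : 1 ≤ E s ^ (ν + ε) := Real.one_le_rpow (hE1 s) (by linarith)
      have hP : ‖X₀ - J.comp ((Tb s (s + r)).comp ((Q (s + r)).comp (W s)))‖ ≤
          (1 + K * Kt * N ^ ν * N ^ a) * E s ^ (ν + ε) := by
        refine (norm_sub_le _ _).trans ?_
        have h0 : ‖J.comp ((Tb s (s + r)).comp ((Q (s + r)).comp (W s)))‖ ≤
            ‖(Tb s (s + r)).comp ((Q (s + r)).comp (W s))‖ := by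
          refine ContinuousLinearMap.opNorm_le_bound _ (norm_nonneg _) fun x => ?_
          rw [ContinuousLinearMap.comp_apply, hJ]
          exact ContinuousLinearMap.le_opNorm _ x
        linarith
      have hone : 1 ≤ N ^ α * (μ t / μ s) ^ (-α) := by
        rw [Real.rpow_neg (hdivpos _ _).le, ← div_eq_mul_inv,
          one_le_div (Real.rpow_pos_of_pos (hdivpos _ _) _)]
        exact Real.rpow_le_rpow (hdivpos _ _).le (hdN s t h) hα.le
      have hEe : E s ^ ε * E s ^ (ν + ε) ≤ E s ^ (θ + ε) := by
        rw [← Real.rpow_add (hE0 s)]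
        exact Real.rpow_le_rpow_of_exponent_le (hE1 s) (by linarith)
      have hc : 0 < Kt * N ^ a * (1 + K * Kt * N ^ ν * N ^ a) := by positivity
      have hEθ := Real.rpow_pos_of_pos (hE0 s) (θ + ε)
      calc _ ≤ (Kt * N ^ a * E s ^ ε) * ((1 + K * Kt * N ^ ν * N ^ a) * E s ^ (ν + ε)) :=
            mul_le_mul hT hP (norm_nonneg _) (by have := hE0 s; positivity)
        _ = (Kt * N ^ a * (1 + K * Kt * N ^ ν * N ^ a)) * (E s ^ ε * E s ^ (ν + ε)) * 1 := by ring
        _ ≤ (Kt * N ^ a * (1 + K * Kt * N ^ ν * N ^ a)) * E s ^ (θ + ε) *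
              (N ^ α * (μ t / μ s) ^ (-α)) := by
            refine mul_le_mul (mul_le_mul_of_nonneg_left hEe hc.le) hone zero_le_one ?_
            exact (mul_pos hc hEθ).le
        _ = _ := by ring
  · intro t s hts
    refine hfin (K * Kt * N ^ ν * N ^ a) _ _ _ _ (by linarith)
        (Real.rpow_pos_of_pos (hdivpos _ _) _) (Real.rpow_pos_of_pos (hE0 _) _) ?_
    have e : (Tb t s).comp ((Tb s (s + r)).comp ((Q (s + r)).comp (W s))) =
        ((Tb t (s + r)).comp (Q (s + r))).comp (W s) := by
      rw [← hcoc t s hts]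
      rfl
    rw [e]
    exact hQb t s hts
end

section
/- Let μ be a differentiable growth rate, let α, D, δ > 0, θ, ε ≥ 0 and γ > θ. Suppose G_s(t,τ) : ℝⁿ → C (t ≥ τ) are bounded linear operators with ‖G_s(t,τ)‖ ≤ D (μ(t)/μ(τ))^{−α} μ(τ)^{sgn(τ)(θ+ε)}, and v : ℝ → ℝⁿ is a measurable function with |v(τ)| ≤ δ μ′(τ) μ(τ)^{−sgn(τ)(γ+ε)−1} for all τ. Then for every t ∈ ℝ, the function τ ↦ ‖G_s(t,τ)‖ · |v(τ)| is integrable on (−∞, t] and ∫_{−∞}^{t} ‖G_s(t,τ)‖ · |v(τ)| dτ ≤ Dδ/α. -/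
open Filter MeasureTheory

/-- integrability of `τ ↦ ‖G_s(t,τ)‖ |v(τ)|` on `(−∞,t]` and the
bound `∫_{−∞}^{t} ‖G_s(t,τ)‖ |v(τ)| dτ ≤ Dδ/α`. -/
theorem stmt7 {n : ℕ}
    {C : Type*} [NormedAddCommGroup C] [NormedSpace ℝ C] [CompleteSpace C]
    (μ : ℝ → ℝ)
    (hμpos : ∀ t, 0 < μ t) (hμmono : StrictMono μ) (hμ0 : μ 0 = 1)
    (hμtop : Tendsto μ atTop atTop) (hμbot : Tendsto μ atBot (nhds 0))
    (hμdiff : Differentiable ℝ μ)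
    (α D δ θ ε γ : ℝ)
    (hα : 0 < α) (hD : 0 < D) (hδ : 0 < δ) (hθ : 0 ≤ θ) (hε : 0 ≤ ε) (hγ : θ < γ)
    (Gs : ℝ → ℝ → (Fin n → ℝ) →L[ℝ] C)
    (hGsm : ∀ t, Measurable fun τ => ‖Gs t τ‖)
    (hGs : ∀ τ t : ℝ, τ ≤ t →
      ‖Gs t τ‖ ≤ D * (μ t / μ τ) ^ (-α) * μ τ ^ (Real.sign τ * (θ + ε)))
    (v : ℝ → Fin n → ℝ) (hv : Measurable v)
    (hvb : ∀ τ : ℝ, ‖v τ‖ ≤ δ * deriv μ τ * μ τ ^ (-(Real.sign τ) * (γ + ε) - 1)) :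
    ∀ t : ℝ,
      IntegrableOn (fun τ => ‖Gs t τ‖ * ‖v τ‖) (Set.Iic t) ∧
      (∫ τ in Set.Iic t, ‖Gs t τ‖ * ‖v τ‖) ≤ D * δ / α := by
  intro t
  have hd0 : ∀ τ, 0 ≤ deriv μ τ := fun τ => hμmono.monotone.deriv_nonneg
  set K : ℝ := D * δ / α * μ t ^ (-α) with hK
  have hK0 : 0 ≤ K := by
    have := Real.rpow_nonneg (hμpos t).le (-α)
    positivity
  set F' : ℝ → ℝ := fun τ => K * (deriv μ τ * α * μ τ ^ (α - 1)) with hF'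
  have hder : ∀ τ, HasDerivAt (fun τ => K * μ τ ^ α) (F' τ) τ := fun τ =>
    ((hμdiff τ).hasDerivAt.rpow_const (Or.inl (hμpos τ).ne')).const_mul K
  have hF'0 : ∀ τ, 0 ≤ F' τ := by
    intro τ
    have := Real.rpow_nonneg (hμpos τ).le (α - 1)
    have := hd0 τ
    positivity
  have hcont : Continuous (fun τ => K * μ τ ^ α) :=
    continuous_iff_continuousAt.2 fun τ => (hder τ).continuousAt
  have hlim : Tendsto (fun τ => K * μ τ ^ α) atBot (nhds 0) := by
    have := (hμbot.rpow_const (p := α) (Or.inr hα.le)).const_mul K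
    simpa [Real.zero_rpow hα.ne'] using this
  have hIoc : ∀ a, IntegrableOn F' (Set.Ioc a t) := fun a =>
    intervalIntegral.integrableOn_deriv_of_nonneg hcont.continuousOn
      (fun x _ => hder x) (fun x _ => hF'0 x)
  have hint : IntegrableOn F' (Set.Iic t) := by
    refine integrableOn_Iic_of_intervalIntegral_norm_bounded (l := atBot) (a := id)
      (K * μ t ^ α) t (fun a => hIoc a) tendsto_id ?_
    filter_upwards [eventually_le_atBot t] with a ha
    have h1 : ∀ x, ‖F' x‖ = F' x := fun x => Real.norm_of_nonneg (hF'0 x)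
    simp only [h1, id]
    rw [intervalIntegral.integral_eq_sub_of_hasDerivAt (fun x _ => hder x)
      ((intervalIntegrable_iff_integrableOn_Ioc_of_le ha).2 (hIoc a))]
    have := mul_nonneg hK0 (Real.rpow_nonneg (hμpos a).le α)
    linarith
  have hval : ∫ τ in Set.Iic t, F' τ = D * δ / α := by
    rw [integral_Iic_of_hasDerivAt_of_tendsto' (fun x _ => hder x) hint hlim, hK, mul_assoc,
      ← Real.rpow_add (hμpos t)]
    simp
  have hbd : ∀ τ ∈ Set.Iic t, ‖Gs t τ‖ * ‖v τ‖ ≤ F' τ := by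
    intro τ hτ
    have hp := hμpos τ
    have hle : μ τ ^ (Real.sign τ * (θ - γ)) ≤ 1 := by
      rcases lt_trichotomy τ 0 with h | h | h
      · rw [Real.sign_of_neg h]
        exact Real.rpow_le_one hp.le (by rw [← hμ0]; exact (hμmono h).le) (by linarith)
      · simp [h]
      · rw [Real.sign_of_pos h]
        exact Real.rpow_le_one_of_one_le_of_nonpos (by rw [← hμ0]; exact (hμmono h).le)
          (by linarith)
    have hA : (μ t / μ τ) ^ (-α) = μ t ^ (-α) * μ τ ^ α := by
      rw [Real.div_rpow (hμpos t).le hp.le, Real.rpow_neg hp.le, div_inv_eq_mul]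
    have hB : μ τ ^ α * μ τ ^ (Real.sign τ * (θ + ε)) *
        μ τ ^ (-(Real.sign τ) * (γ + ε) - 1) =
        μ τ ^ (α - 1) * μ τ ^ (Real.sign τ * (θ - γ)) := by
      rw [← Real.rpow_add hp, ← Real.rpow_add hp, ← Real.rpow_add hp]
      congr 1
      ring
    calc ‖Gs t τ‖ * ‖v τ‖ ≤ _ :=
          mul_le_mul (hGs τ t hτ) (hvb τ) (norm_nonneg _) ((norm_nonneg _).trans (hGs τ t hτ))
      _ = D * δ * μ t ^ (-α) * deriv μ τ * (μ τ ^ α * μ τ ^ (Real.sign τ * (θ + ε)) *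
        μ τ ^ (-(Real.sign τ) * (γ + ε) - 1)) := by rw [hA]; ring
      _ = F' τ * μ τ ^ (Real.sign τ * (θ - γ)) := by
        rw [hB, hF', hK]
        field_simp
      _ ≤ F' τ := mul_le_of_le_one_right (hF'0 τ) hle
  have hI : IntegrableOn (fun τ => ‖Gs t τ‖ * ‖v τ‖) (Set.Iic t) := by
    refine Integrable.mono' hint ((hGsm t).mul hv.norm).aestronglyMeasurable ?_
    filter_upwards [ae_restrict_mem measurableSet_Iic] with τ hτ
    rw [Real.norm_of_nonneg (by positivity)]
    exact hbd τ hτ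
  exact ⟨hI, hval ▸ setIntegral_mono_on hI hint measurableSet_Iic hbd⟩
end

section
/- Let μ be a differentiable growth rate, let β, D, δ > 0, ν, ε ≥ 0 and γ > ν. Suppose G_u(t,τ) : ℝⁿ → C (t ≤ τ) are bounded linear operators with ‖G_u(t,τ)‖ ≤ D (μ(t)/μ(τ))^{β} μ(τ)^{sgn(τ)(ν+ε)}, and v : ℝ → ℝⁿ is a measurable function with |v(τ)| ≤ δ μ′(τ) μ(τ)^{−sgn(τ)(γ+ε)−1} for all τ. Then for every t ∈ ℝ, the function τ ↦ ‖G_u(t,τ)‖ · |v(τ)| is integrable on [t, +∞) and ∫_{t}^{+∞} ‖G_u(t,τ)‖ · |v(τ)| dτ ≤ Dδ/β. -/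
open Filter MeasureTheory

/-- integrability of `τ ↦ ‖G_u(t,τ)‖ |v(τ)|` on `[t,+∞)` and the
bound `∫_{t}^{+∞} ‖G_u(t,τ)‖ |v(τ)| dτ ≤ Dδ/β`. -/
theorem stmt8 {n : ℕ}
    {C : Type*} [NormedAddCommGroup C] [NormedSpace ℝ C] [CompleteSpace C]
    (μ : ℝ → ℝ)
    (hμpos : ∀ t, 0 < μ t) (hμmono : StrictMono μ) (hμ0 : μ 0 = 1)
    (hμtop : Tendsto μ atTop atTop) (hμbot : Tendsto μ atBot (nhds 0))
    (hμdiff : Differentiable ℝ μ)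
    (β D δ ν ε γ : ℝ)
    (hβ : 0 < β) (hD : 0 < D) (hδ : 0 < δ) (hν : 0 ≤ ν) (hε : 0 ≤ ε) (hγ : ν < γ)
    (Gu : ℝ → ℝ → (Fin n → ℝ) →L[ℝ] C)
    (hGum : ∀ t, Measurable fun τ => ‖Gu t τ‖)
    (hGu : ∀ τ t : ℝ, t ≤ τ →
      ‖Gu t τ‖ ≤ D * (μ t / μ τ) ^ β * μ τ ^ (Real.sign τ * (ν + ε)))
    (v : ℝ → Fin n → ℝ) (hv : Measurable v)
    (hvb : ∀ τ : ℝ, ‖v τ‖ ≤ δ * deriv μ τ * μ τ ^ (-(Real.sign τ) * (γ + ε) - 1)) :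
    ∀ t : ℝ,
      IntegrableOn (fun τ => ‖Gu t τ‖ * ‖v τ‖) (Set.Ici t) ∧
      (∫ τ in Set.Ici t, ‖Gu t τ‖ * ‖v τ‖) ≤ D * δ / β := by
  intro t
  have hd : ∀ τ, 0 ≤ deriv μ τ := fun τ => hμmono.monotone.deriv_nonneg
  set g : ℝ → ℝ := fun τ => -(D * δ / β * μ t ^ β) * μ τ ^ (-β) with hg
  set g' : ℝ → ℝ := fun τ => D * δ * μ t ^ β * (deriv μ τ * μ τ ^ (-β - 1)) with hg'
  have hder : ∀ τ, HasDerivAt g (g' τ) τ := by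
    intro τ
    have h := (((hμdiff τ).hasDerivAt.rpow_const (p := -β) (Or.inl (hμpos τ).ne'))).const_mul
      (-(D * δ / β * μ t ^ β))
    refine HasDerivAt.congr_deriv (f := g) h ?_
    simp only [hg']
    field_simp
  have hnn : ∀ τ, 0 ≤ g' τ := by
    intro τ
    have h1 := hd τ
    have h2 := (hμpos τ).le
    have h3 := (hμpos t).le
    simp only [hg']
    positivity
  have hlim : Tendsto g atTop (nhds 0) := by
    have h := ((tendsto_rpow_neg_atTop hβ).comp hμtop).const_mul (-(D * δ / β * μ t ^ β))
    rw [mul_zero] at h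
    exact h
  have hint : IntegrableOn g' (Set.Ioi t) :=
    integrableOn_Ioi_deriv_of_nonneg' (fun x _ => hder x) (fun x _ => hnn x) hlim
  have hval : ∫ τ in Set.Ioi t, g' τ = 0 - g t :=
    integral_Ioi_of_hasDerivAt_of_nonneg' (fun x _ => hder x) (fun x _ => hnn x) hlim
  have hgt : 0 - g t = D * δ / β := by
    have h : μ t ^ β * μ t ^ (-β) = 1 := by
      rw [← Real.rpow_add (hμpos t)]; simp
    simp only [hg]
    linear_combination (D * δ / β) * h
  have hle : ∀ τ ∈ Set.Ici t, ‖Gu t τ‖ * ‖v τ‖ ≤ g' τ := by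
    intro τ hτ
    have hm := hμpos τ
    have h1 : ‖Gu t τ‖ * ‖v τ‖ ≤ (D * (μ t / μ τ) ^ β * μ τ ^ (Real.sign τ * (ν + ε))) *
        (δ * deriv μ τ * μ τ ^ (-(Real.sign τ) * (γ + ε) - 1)) :=
      mul_le_mul (hGu τ t hτ) (hvb τ) (norm_nonneg _) ((norm_nonneg _).trans (hGu τ t hτ))
    have h2 : (D * (μ t / μ τ) ^ β * μ τ ^ (Real.sign τ * (ν + ε))) *
        (δ * deriv μ τ * μ τ ^ (-(Real.sign τ) * (γ + ε) - 1))
        = g' τ * μ τ ^ (Real.sign τ * (ν - γ)) := by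
      have e1 : (μ t / μ τ) ^ β = μ t ^ β * μ τ ^ (-β) := by
        rw [Real.div_rpow (hμpos t).le hm.le, Real.rpow_neg hm.le, div_eq_mul_inv]
      have e2 : μ τ ^ (-β) * μ τ ^ (Real.sign τ * (ν + ε)) *
          μ τ ^ (-(Real.sign τ) * (γ + ε) - 1)
          = μ τ ^ (-β - 1) * μ τ ^ (Real.sign τ * (ν - γ)) := by
        rw [← Real.rpow_add hm, ← Real.rpow_add hm, ← Real.rpow_add hm]
        congr 1
        ring
      rw [e1]
      simp only [hg']
      linear_combination (D * δ * μ t ^ β * deriv μ τ) * e2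
    have h3 : μ τ ^ (Real.sign τ * (ν - γ)) ≤ 1 := by
      rcases lt_trichotomy τ 0 with h | h | h
      · rw [Real.sign_of_neg h]
        have : μ τ ≤ 1 := hμ0 ▸ (hμmono h).le
        exact Real.rpow_le_one hm.le this (by linarith)
      · simp [h]
      · rw [Real.sign_of_pos h]
        have : 1 ≤ μ τ := hμ0 ▸ (hμmono h).le
        exact Real.rpow_le_one_of_one_le_of_nonpos this (by linarith)
    calc _ ≤ _ := h1
      _ = _ := h2
      _ ≤ g' τ := mul_le_of_le_one_right (hnn τ) h3
  have hint' : IntegrableOn g' (Set.Ici t) := by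
    rwa [integrableOn_Ici_iff_integrableOn_Ioi]
  have hI : IntegrableOn (fun τ => ‖Gu t τ‖ * ‖v τ‖) (Set.Ici t) := by
    refine Integrable.mono' hint' ((hGum t).mul hv.norm).aestronglyMeasurable ?_
    refine (ae_restrict_iff' measurableSet_Ici).mpr (Eventually.of_forall fun τ hτ => ?_)
    rw [Real.norm_of_nonneg (by positivity)]
    exact hle τ hτ
  refine ⟨hI, ?_⟩
  calc _ ≤ ∫ τ in Set.Ici t, g' τ := setIntegral_mono_on hI hint' measurableSet_Ici hle
    _ = D * δ / β := by rw [integral_Ici_eq_integral_Ioi, hval, hgt]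
end

section
/- In the F-setting below, for every bounded function η on {(t,b) : t ∈ ℝ, b ∈ U(t)} with values in C, both integrals defining F(η)(t,b) converge absolutely for every t ∈ ℝ and b ∈ U(t), and ‖F(η)‖_∞ := sup_{t,b} ‖F(η)(t,b)‖ ≤ Dδ(α+β)/(αβ). -/
open Filter MeasureTheory

/-- The operator `F` from the paper:
`F(η)(t,b) = ∫_{−∞}^{t} G_s(t,τ) g(τ, T̄(τ,t)b + η(τ,T̄(τ,t)b)) dτ
            − ∫_{t}^{+∞} G_u(t,τ) g(τ, T(τ,t)b + η(τ,T(τ,t)b)) dτ`. -/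
noncomputable def Fop {n : ℕ} {C : Type*} [NormedAddCommGroup C] [NormedSpace ℝ C]
    (Gs Gu : ℝ → ℝ → (Fin n → ℝ) →L[ℝ] C)
    (Tb T : ℝ → ℝ → C →L[ℝ] C)
    (g : ℝ → C → Fin n → ℝ)
    (η : ℝ → C → C) (t : ℝ) (b : C) : C :=
  (∫ τ in Set.Iic t, Gs t τ (g τ (Tb τ t b + η τ (Tb τ t b)))) -
  (∫ τ in Set.Ici t, Gu t τ (g τ (T τ t b + η τ (T τ t b))))


theorem aux_Ici {C : Type*} [NormedAddCommGroup C] [NormedSpace ℝ C]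
    (f : ℝ → C) (hf : Continuous f) (H h : ℝ → ℝ) (l t : ℝ)
    (hH : ∀ x, HasDerivAt H (h x) x) (hh : ∀ x, 0 ≤ h x)
    (hl : Tendsto H atTop (nhds l)) (hb : ∀ x, t ≤ x → ‖f x‖ ≤ h x) :
    IntegrableOn f (Set.Ici t) ∧ ‖∫ x in Set.Ici t, f x‖ ≤ l - H t := by
  have hi : IntegrableOn h (Set.Ioi t) :=
    integrableOn_Ioi_deriv_of_nonneg' (fun x _ => hH x) (fun x _ => hh x) hl
  have hv : ∫ x in Set.Ioi t, h x = l - H t :=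
    integral_Ioi_of_hasDerivAt_of_nonneg' (fun x _ => hH x) (fun x _ => hh x) hl
  have hae : ∀ᵐ x ∂(volume.restrict (Set.Ioi t)), ‖f x‖ ≤ h x := by
    filter_upwards [ae_restrict_mem measurableSet_Ioi] with x hx
    exact hb x (le_of_lt hx)
  constructor
  · rw [integrableOn_Ici_iff_integrableOn_Ioi]
    exact Integrable.mono' hi hf.aestronglyMeasurable hae
  · rw [integral_Ici_eq_integral_Ioi, ← hv]
    exact norm_integral_le_of_norm_le hi hae

theorem aux_Iic {C : Type*} [NormedAddCommGroup C] [NormedSpace ℝ C]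
    (f : ℝ → C) (hf : Continuous f) (H h : ℝ → ℝ) (l t : ℝ)
    (hH : ∀ x, HasDerivAt H (h x) x) (hh : ∀ x, 0 ≤ h x)
    (hl : Tendsto H atBot (nhds l)) (hb : ∀ x, x ≤ t → ‖f x‖ ≤ h x) :
    IntegrableOn f (Set.Iic t) ∧ ‖∫ x in Set.Iic t, f x‖ ≤ H t - l := by
  have key := aux_Ici (fun x => f (-x)) (hf.comp continuous_neg) (fun x => - H (-x))
    (fun x => h (-x)) (-l) (-t)
    (fun x => by
      have h1 := ((hH (-x)).comp x (hasDerivAt_neg x)).neg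
      have h2 : -(h (-x) * -1) = h (-x) := by ring
      rw [h2] at h1
      exact h1)
    (fun x => hh _) ((hl.comp tendsto_neg_atTop_atBot).neg)
    (fun x hx => hb _ (by linarith))
  constructor
  · have := IntegrableOn.comp_neg_Iic (c := t) key.1
    simpa using this
  · have h2 := key.2
    rw [integral_Ici_eq_integral_Ioi, integral_comp_neg_Ioi] at h2
    simp only [neg_neg] at h2
    linarith

theorem aux_cont {n : ℕ} {C : Type*} [NormedAddCommGroup C] [NormedSpace ℝ C]
    (G : ℝ → (Fin n → ℝ) →L[ℝ] C) (hG : ∀ p, Continuous fun τ => G τ p)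
    (v : ℝ → Fin n → ℝ) (hv : Continuous v) : Continuous fun τ => G τ (v τ) := by
  have : (fun τ => G τ (v τ)) = fun τ => ∑ i, v τ i • G τ (fun j => if i = j then 1 else 0) := by
    funext τ
    exact LinearMap.pi_apply_eq_sum_univ (G τ).toLinearMap (v τ)
  rw [this]
  exact continuous_finsetSum _ fun i _ => ((continuous_apply i).comp hv).smul (hG _)

theorem aux_weight (μ : ℝ → ℝ) (hμpos : ∀ t, 0 < μ t) (hμmono : StrictMono μ) (hμ0 : μ 0 = 1)
    (θ ε γ : ℝ) (h : θ < γ) (τ : ℝ) :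
    μ τ ^ (Real.sign τ * (θ + ε)) * μ τ ^ (-(Real.sign τ) * (γ + ε) - 1) ≤ μ τ ^ (-1 : ℝ) := by
  have e : Real.sign τ * (θ + ε) + (-(Real.sign τ) * (γ + ε) - 1)
      = Real.sign τ * (θ - γ) + (-1) := by ring
  rw [← Real.rpow_add (hμpos τ), e, Real.rpow_add (hμpos τ)]
  have : μ τ ^ (Real.sign τ * (θ - γ)) ≤ 1 := by
    rcases lt_trichotomy τ 0 with h0 | h0 | h0
    · rw [Real.sign_of_neg h0]
      exact Real.rpow_le_one (hμpos τ).le (hμ0 ▸ (hμmono h0).le) (by linarith)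
    · simp [h0]
    · rw [Real.sign_of_pos h0]
      exact Real.rpow_le_one_of_one_le_of_nonpos (hμ0 ▸ (hμmono h0).le) (by linarith)
  have h1 : 0 ≤ μ τ ^ (-1 : ℝ) := Real.rpow_nonneg (hμpos τ).le _
  nlinarith

/-- pointwise bound -/
theorem aux_bound {n : ℕ} {C : Type*} [NormedAddCommGroup C] [NormedSpace ℝ C]
    (G : (Fin n → ℝ) →L[ℝ] C) (v : Fin n → ℝ) (D δ r m d w1 w2 w : ℝ)
    (hD : 0 < D) (hδ : 0 < δ) (hr : 0 ≤ r) (hd : 0 ≤ d) (hw1 : 0 ≤ w1) (hw2 : 0 ≤ w2)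
    (hm : m ≤ 1)
    (hG : ‖G‖ ≤ D * r * w1) (hv : ‖v‖ ≤ δ * m * d * w2) (hw : w1 * w2 ≤ w) :
    ‖G v‖ ≤ D * δ * (r * w * d) := by
  have hv' : ‖v‖ ≤ δ * d * w2 := by
    have : δ * m * d * w2 ≤ δ * 1 * d * w2 := by gcongr
    linarith
  calc ‖G v‖ ≤ ‖G‖ * ‖v‖ := G.le_opNorm v
    _ ≤ (D * r * w1) * (δ * d * w2) := by gcongr
    _ = D * δ * (r * (w1 * w2) * d) := by ring
    _ ≤ _ := by gcongr

/-- in the F-setting, for every bounded (continuous) `η` on the bundle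
`{(t,b) : b ∈ U(t)}`, both integrals defining `F(η)(t,b)` converge absolutely and
`‖F(η)(t,b)‖ ≤ Dδ(α+β)/(αβ)` for all `t ∈ ℝ`, `b ∈ U(t)`. -/
theorem stmt9 {n : ℕ}
    {C : Type*} [NormedAddCommGroup C] [NormedSpace ℝ C] [CompleteSpace C]
    (μ : ℝ → ℝ)
    (hμpos : ∀ t, 0 < μ t) (hμmono : StrictMono μ) (hμ0 : μ 0 = 1)
    (hμtop : Tendsto μ atTop atTop) (hμbot : Tendsto μ atBot (nhds 0))
    (hμdiff : Differentiable ℝ μ)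
    (α β D δ θ ν ε γ : ℝ)
    (hα : 0 < α) (hβ : 0 < β) (hD : 0 < D) (hδ : 0 < δ)
    (hθ : 0 ≤ θ) (hν : 0 ≤ ν) (hε : 0 ≤ ε) (hγ : max θ ν < γ)
    (U : ℝ → Submodule ℝ C) (hUcl : ∀ t, IsClosed (U t : Set C))
    (Tb T : ℝ → ℝ → C →L[ℝ] C)
    (hTbU : ∀ τ t : ℝ, τ ≤ t → ∀ b ∈ U t, Tb τ t b ∈ U τ)
    (hTU : ∀ τ t : ℝ, t ≤ τ → ∀ b ∈ U t, T τ t b ∈ U τ)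
    (hTbc : ∀ b : C, Continuous fun p : ℝ × ℝ => Tb p.1 p.2 b)
    (hTc : ∀ b : C, Continuous fun p : ℝ × ℝ => T p.1 p.2 b)
    (Gs Gu : ℝ → ℝ → (Fin n → ℝ) →L[ℝ] C)
    (hGs : ∀ τ t : ℝ, τ ≤ t →
      ‖Gs t τ‖ ≤ D * (μ t / μ τ) ^ (-α) * μ τ ^ (Real.sign τ * (θ + ε)))
    (hGu : ∀ τ t : ℝ, t ≤ τ →
      ‖Gu t τ‖ ≤ D * (μ t / μ τ) ^ β * μ τ ^ (Real.sign τ * (ν + ε)))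
    (hGsc : ∀ p : Fin n → ℝ, Continuous fun q : ℝ × ℝ => Gs q.1 q.2 p)
    (hGuc : ∀ p : Fin n → ℝ, Continuous fun q : ℝ × ℝ => Gu q.1 q.2 p)
    (g : ℝ → C → Fin n → ℝ)
    (hgc : Continuous fun p : ℝ × C => g p.1 p.2)
    (hg0 : ∀ t, g t 0 = 0)
    (hglip : ∀ (t : ℝ) (φ ψ : C), ‖g t φ - g t ψ‖ ≤
      δ * min 1 ‖φ - ψ‖ * deriv μ t * μ t ^ (-(Real.sign t) * (γ + ε) - 1))
    (η : ℝ → C → C)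
    (hηc : Continuous fun p : ℝ × C => η p.1 p.2)
    (hηb : ∃ M : ℝ, ∀ t : ℝ, ∀ b ∈ U t, ‖η t b‖ ≤ M) :
    ∀ t : ℝ, ∀ b ∈ U t,
      IntegrableOn (fun τ => Gs t τ (g τ (Tb τ t b + η τ (Tb τ t b)))) (Set.Iic t) ∧
      IntegrableOn (fun τ => Gu t τ (g τ (T τ t b + η τ (T τ t b)))) (Set.Ici t) ∧
      ‖Fop Gs Gu Tb T g η t b‖ ≤ D * δ * (α + β) / (α * β) := by
  intro t b hb
  have hd : ∀ x, 0 ≤ deriv μ x := fun x => hμmono.monotone.deriv_nonneg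
  have hθγ : θ < γ := lt_of_le_of_lt (le_max_left _ _) hγ
  have hνγ : ν < γ := lt_of_le_of_lt (le_max_right _ _) hγ
  have hgn : ∀ τ φ, ‖g τ φ‖ ≤ δ * min 1 ‖φ‖ * deriv μ τ *
      μ τ ^ (-(Real.sign τ) * (γ + ε) - 1) := by
    intro τ φ
    simpa [hg0] using hglip τ φ 0
  have hTb1 : Continuous fun τ => Tb τ t b := (hTbc b).comp (by fun_prop : Continuous fun τ : ℝ => (τ, t))
  have hT1 : Continuous fun τ => T τ t b := (hTc b).comp (by fun_prop : Continuous fun τ : ℝ => (τ, t))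
  have hc1 : Continuous fun τ => Gs t τ (g τ (Tb τ t b + η τ (Tb τ t b))) := by
    refine aux_cont (fun τ => Gs t τ)
      (fun p => (hGsc p).comp (by fun_prop : Continuous fun τ : ℝ => (t, τ))) _ ?_
    exact hgc.comp (continuous_id.prodMk (hTb1.add (hηc.comp (continuous_id.prodMk hTb1))))
  have hc2 : Continuous fun τ => Gu t τ (g τ (T τ t b + η τ (T τ t b))) := by
    refine aux_cont (fun τ => Gu t τ)
      (fun p => (hGuc p).comp (by fun_prop : Continuous fun τ : ℝ => (t, τ))) _ ?_
    exact hgc.comp (continuous_id.prodMk (hT1.add (hηc.comp (continuous_id.prodMk hT1))))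
  have hr0 : ∀ x (a : ℝ), 0 ≤ μ x ^ a := fun x a => Real.rpow_nonneg (hμpos x).le a
  have hderiv : ∀ (K a : ℝ), ∀ x, HasDerivAt (fun x => K * μ x ^ a)
      (K * (deriv μ x * a * μ x ^ (a - 1))) x := fun K a x =>
    (((hμdiff x).hasDerivAt).rpow_const (Or.inl (hμpos x).ne')).const_mul K
  have k1 := aux_Iic _ hc1 (fun x => (D * δ * μ t ^ (-α) / α) * μ x ^ α) _ 0 t
    (hderiv _ α)
    (fun x => by have := hr0 x (α - 1); have := hr0 t (-α); have := hd x; positivity)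
    (by
      have := (hμbot.rpow_const (p := α) (Or.inr hα.le)).const_mul (D * δ * μ t ^ (-α) / α)
      simpa [Real.zero_rpow hα.ne'] using this)
    (fun τ hτ => by
      have := aux_bound (Gs t τ) (g τ (Tb τ t b + η τ (Tb τ t b))) D δ _ _ (deriv μ τ) _ _ _ hD hδ
        (Real.rpow_nonneg (div_pos (hμpos t) (hμpos τ)).le _) (hd τ) (hr0 _ _) (hr0 _ _)
        (min_le_left 1 _) (hGs τ t hτ) (hgn τ _)
        (aux_weight μ hμpos hμmono hμ0 θ ε γ hθγ τ)
      refine this.trans (le_of_eq ?_)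
      rw [Real.div_rpow (hμpos t).le (hμpos τ).le, Real.rpow_neg (hμpos τ).le α,
        sub_eq_add_neg α 1, Real.rpow_add (hμpos τ)]
      field_simp)
  have k2 := aux_Ici _ hc2 (fun x => (-(D * δ * μ t ^ β / β)) * μ x ^ (-β)) _ 0 t
    (hderiv _ (-β))
    (fun x => by
      have := hr0 x (-β - 1); have := hr0 t β; have := hd x
      have : 0 ≤ (D * δ * μ t ^ β / β) * (deriv μ x * β * μ x ^ (-β - 1)) := by positivity
      linarith)
    (by
      have := ((tendsto_rpow_neg_atTop hβ).comp hμtop).const_mul (-(D * δ * μ t ^ β / β))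
      simpa using this)
    (fun τ hτ => by
      have := aux_bound (Gu t τ) (g τ (T τ t b + η τ (T τ t b))) D δ _ _ (deriv μ τ) _ _ _ hD hδ
        (Real.rpow_nonneg (div_pos (hμpos t) (hμpos τ)).le _) (hd τ) (hr0 _ _) (hr0 _ _)
        (min_le_left 1 _) (hGu τ t hτ) (hgn τ _)
        (aux_weight μ hμpos hμmono hμ0 ν ε γ hνγ τ)
      refine this.trans (le_of_eq ?_)
      rw [Real.div_rpow (hμpos t).le (hμpos τ).le,
        sub_eq_add_neg (-β) 1, Real.rpow_add (hμpos τ), Real.rpow_neg (hμpos τ).le β]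
      field_simp)
  refine ⟨k1.1, k2.1, ?_⟩
  have e1 : (D * δ * μ t ^ (-α) / α) * μ t ^ α - 0 = D * δ / α := by
    have := (Real.rpow_pos_of_pos (hμpos t) α).ne'
    rw [Real.rpow_neg (hμpos t).le]
    field_simp
    simp
  have e2 : 0 - (-(D * δ * μ t ^ β / β)) * μ t ^ (-β) = D * δ / β := by
    have := (Real.rpow_pos_of_pos (hμpos t) β).ne'
    rw [Real.rpow_neg (hμpos t).le]
    field_simp
    simp
  have e3 : D * δ * (α + β) / (α * β) = D * δ / α + D * δ / β := by
    field_simp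
    ring
  rw [e3, ← e1, ← e2]
  unfold Fop
  exact (norm_sub_le _ _).trans (add_le_add k1.2 k2.2)
end

section
/- (Topological-equivalence theorem, fixed-point form.) In the F-setting below, assume additionally that Dδ(α+β)/(αβ) < 1. Then there exists a unique bounded function η on {(t,b) : t ∈ ℝ, b ∈ U(t)} with values in C satisfying F(η) = η, and this η satisfies ‖η‖_∞ ≤ Dδ(α+β)/(αβ) < 1, where ‖η‖_∞ := sup_{t,b} ‖η(t,b)‖. -/
open Filter MeasureTheory

theorem aux_strong {P E F : Type*} [TopologicalSpace P] [WeaklyLocallyCompactSpace P]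
    [NormedAddCommGroup E] [NormedSpace ℝ E] [CompleteSpace E]
    [NormedAddCommGroup F] [NormedSpace ℝ F] (L : P → E →L[ℝ] F)
    (h : ∀ x, Continuous fun p => L p x) :
    Continuous fun q : P × E => L q.1 q.2 := by
  rw [continuous_iff_continuousAt]
  rintro ⟨p0, x0⟩
  obtain ⟨K, hK, hKn⟩ := exists_compact_mem_nhds p0
  obtain ⟨M, hM⟩ : ∃ M, ∀ p : K, ‖L p‖ ≤ M := by
    apply banach_steinhaus
    intro x
    obtain ⟨c, hc⟩ := hK.exists_bound_of_continuousOn (h x).continuousOn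
    exact ⟨c, fun p => hc p p.2⟩
  have h1 : Tendsto (fun q : P × E => L q.1 (q.2 - x0)) (nhds (p0, x0)) (nhds 0) := by
    apply squeeze_zero_norm' (a := fun q : P × E => M * ‖q.2 - x0‖)
    · have : ∀ᶠ q : P × E in nhds (p0, x0), q.1 ∈ K :=
        (continuous_fst.tendsto (p0, x0)).eventually hKn
      filter_upwards [this] with q hq
      exact (L q.1).le_of_opNorm_le (hM ⟨q.1, hq⟩) _
    · have : Continuous fun q : P × E => M * ‖q.2 - x0‖ := by fun_prop
      simpa using this.tendsto (p0, x0)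
  have h2 : Tendsto (fun q : P × E => L q.1 x0) (nhds (p0, x0)) (nhds (L p0 x0)) :=
    ((h x0).comp continuous_fst).tendsto (p0, x0)
  have := h1.add h2
  simpa [ContinuousAt] using this

theorem aux_cont_s11 {C : Type*} [NormedAddCommGroup C] [NormedSpace ℝ C]
    (S : ℝ → Set ℝ) (hSm : ∀ t, MeasurableSet (S t)) (A w : ℝ → ℝ) (hA : Continuous A)
    (hA0 : ∀ t, 0 ≤ A t) (hw0 : ∀ τ, 0 ≤ w τ)
    (hS : ∀ t0, ∃ S0, MeasurableSet S0 ∧ IntegrableOn w S0 ∧ ∀ᶠ t in nhds t0, S t ⊆ S0)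
    (hS' : ∀ t0 τ, τ ≠ t0 → ∀ᶠ t in nhds t0, (τ ∈ S t ↔ τ ∈ S t0))
    (h : ℝ × C → ℝ → C) (hc : Continuous fun q : (ℝ × C) × ℝ => h q.1 q.2)
    (hb : ∀ p : ℝ × C, ∀ τ ∈ S p.1, ‖h p τ‖ ≤ A p.1 * w τ) :
    Continuous fun p : ℝ × C => ∫ τ in S p.1, h p τ := by
  rw [continuous_iff_continuousAt]
  rintro ⟨t0, b0⟩
  obtain ⟨S0, hS0m, hS0i, hS0⟩ := hS t0
  have hfst : Tendsto (fun p : ℝ × C => p.1) (nhds (t0, b0)) (nhds t0) :=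
    continuous_fst.tendsto (t0, b0)
  have hcp : ∀ p, Continuous (h p) := fun p => hc.comp (by fun_prop : Continuous fun τ => (p, τ))
  have hcτ : ∀ τ, Continuous fun p => h p τ := fun τ =>
    hc.comp (by fun_prop : Continuous fun p : ℝ × C => (p, τ))
  have hev : ∀ᶠ t in nhds t0, A t ≤ A t0 + 1 := by
    have := hA.tendsto t0 |>.eventually (Iio_mem_nhds (lt_add_one (A t0)))
    filter_upwards [this] with t ht using le_of_lt ht
  simp_rw [← integral_indicator (hSm _)]
  apply continuousAt_of_dominated (bound := S0.indicator fun τ => (A t0 + 1) * w τ)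
  · filter_upwards with p
    exact (hcp p).aestronglyMeasurable.indicator (hSm _)
  · filter_upwards [hfst.eventually hev, hfst.eventually hS0] with p hp1 hp2
    filter_upwards with τ
    by_cases hτ : τ ∈ S p.1
    · rw [Set.indicator_of_mem hτ, Set.indicator_of_mem (hp2 hτ)]
      exact (hb p τ hτ).trans (mul_le_mul_of_nonneg_right hp1 (hw0 τ))
    · rw [Set.indicator_of_notMem hτ, norm_zero]
      by_cases hτ0 : τ ∈ S0
      · rw [Set.indicator_of_mem hτ0]
        exact mul_nonneg (by linarith [hA0 t0]) (hw0 τ)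
      · rw [Set.indicator_of_notMem hτ0]
  · rw [integrable_indicator_iff hS0m]
    exact hS0i.const_mul _
  · have : ∀ᵐ τ : ℝ, τ ≠ t0 := by simp [ae_iff]
    filter_upwards [this] with τ hτ
    have h1 := hfst.eventually (hS' t0 τ hτ)
    by_cases hm : τ ∈ S t0
    · apply (hcτ τ).continuousAt.congr
      filter_upwards [h1] with p hp
      rw [Set.indicator_of_mem (hp.2 hm)]
    · apply (continuousAt_const (y := (0:C))).congr
      filter_upwards [h1] with p hp
      rw [Set.indicator_of_notMem (fun h => hm (hp.1 h))]

section side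
variable {C E : Type*} [NormedAddCommGroup C] [NormedSpace ℝ C] [CompleteSpace C]
  [NormedAddCommGroup E] [NormedSpace ℝ E] [CompleteSpace E]

theorem aux_cont2 (G : ℝ → ℝ → E →L[ℝ] C) (R : ℝ → ℝ → C →L[ℝ] C)
    (hG : ∀ p : E, Continuous fun q : ℝ × ℝ => G q.1 q.2 p)
    (hR : ∀ b : C, Continuous fun p : ℝ × ℝ => R p.1 p.2 b)
    (g : ℝ → C → E) (hgc : Continuous fun p : ℝ × C => g p.1 p.2)
    (η : ℝ → C → C) (hη : Continuous fun p : ℝ × C => η p.1 p.2) :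
    Continuous fun q : (ℝ × C) × ℝ =>
      G q.1.1 q.2 (g q.2 (R q.2 q.1.1 q.1.2 + η q.2 (R q.2 q.1.1 q.1.2))) := by
  have hG' := aux_strong (fun q : ℝ × ℝ => G q.1 q.2) hG
  have hR' := aux_strong (fun q : ℝ × ℝ => R q.1 q.2) hR
  have h1 : Continuous fun q : (ℝ × C) × ℝ => R q.2 q.1.1 q.1.2 :=
    hR'.comp (by fun_prop : Continuous fun q : (ℝ × C) × ℝ => ((q.2, q.1.1), q.1.2))
  have h2 : Continuous fun q : (ℝ × C) × ℝ => η q.2 (R q.2 q.1.1 q.1.2) :=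
    hη.comp (continuous_snd.prodMk h1)
  have h3 := hgc.comp (continuous_snd.prodMk (h1.add h2))
  exact hG'.comp ((by fun_prop : Continuous fun q : (ℝ × C) × ℝ => (q.1.1, q.2)).prodMk h3)

/-- The one-sided integral bounds. -/
theorem aux_side (S : ℝ → Set ℝ) (hSm : ∀ t, MeasurableSet (S t)) (A w : ℝ → ℝ)
    (hA : Continuous A) (hA0 : ∀ t, 0 ≤ A t) (hw0 : ∀ τ, 0 ≤ w τ)
    (hS : ∀ t0, ∃ S0, MeasurableSet S0 ∧ IntegrableOn w S0 ∧ ∀ᶠ t in nhds t0, S t ⊆ S0)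
    (hS' : ∀ t0 τ, τ ≠ t0 → ∀ᶠ t in nhds t0, (τ ∈ S t ↔ τ ∈ S t0))
    (κ : ℝ) (hκ : ∀ t, A t * ∫ τ in S t, w τ = κ)
    (G : ℝ → ℝ → E →L[ℝ] C) (R : ℝ → ℝ → C →L[ℝ] C)
    (hG : ∀ p : E, Continuous fun q : ℝ × ℝ => G q.1 q.2 p)
    (hR : ∀ b : C, Continuous fun p : ℝ × ℝ => R p.1 p.2 b)
    (g : ℝ → C → E) (hgc : Continuous fun p : ℝ × C => g p.1 p.2) (hg0 : ∀ t, g t 0 = 0)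
    (hb : ∀ t, ∀ τ ∈ S t, ∀ φ ψ, ‖G t τ (g τ φ - g τ ψ)‖ ≤ min 1 ‖φ - ψ‖ * (A t * w τ))
    (η : ℝ → C → C) (hη : Continuous fun p : ℝ × C => η p.1 p.2) :
    (Continuous fun p : ℝ × C =>
      ∫ τ in S p.1, G p.1 τ (g τ (R τ p.1 p.2 + η τ (R τ p.1 p.2)))) ∧
    (∀ t b, ‖∫ τ in S t, G t τ (g τ (R τ t b + η τ (R τ t b)))‖ ≤ κ) ∧
    (∀ (V : ℝ → Set C), (∀ t, ∀ τ ∈ S t, ∀ b ∈ V t, R τ t b ∈ V τ) →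
      ∀ η' : ℝ → C → C, (Continuous fun p : ℝ × C => η' p.1 p.2) →
      ∀ M : ℝ, (∀ t, ∀ b ∈ V t, ‖η t b - η' t b‖ ≤ M) →
      ∀ t, ∀ b ∈ V t, ‖(∫ τ in S t, G t τ (g τ (R τ t b + η τ (R τ t b)))) -
        ∫ τ in S t, G t τ (g τ (R τ t b + η' τ (R τ t b)))‖ ≤ κ * M) := by
  have hwi : ∀ t, IntegrableOn w (S t) := fun t => by
    obtain ⟨S0, _, hi, he⟩ := hS t
    exact hi.mono_set he.self_of_nhds
  have hbd : ∀ t, ∀ τ ∈ S t, ∀ φ, ‖G t τ (g τ φ)‖ ≤ A t * w τ := by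
    intro t τ hτ φ
    have := hb t τ hτ φ 0
    rw [hg0, sub_zero] at this
    refine this.trans (mul_le_of_le_one_left (mul_nonneg (hA0 t) (hw0 τ)) (min_le_left _ _))
  have hint : ∀ η : ℝ → C → C, (Continuous fun p : ℝ × C => η p.1 p.2) → ∀ t b,
      IntegrableOn (fun τ => G t τ (g τ (R τ t b + η τ (R τ t b)))) (S t) := by
    intro η hη t b
    refine Integrable.mono' ((hwi t).const_mul (A t)) ?_ ?_
    · exact ((aux_cont2 G R hG hR g hgc η hη).comp
        (by fun_prop : Continuous fun τ : ℝ => ((t, b), τ))).aestronglyMeasurable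
    · filter_upwards [ae_restrict_mem (hSm t)] with τ hτ using hbd t τ hτ _
  refine ⟨?_, ?_, ?_⟩
  · exact aux_cont_s11 S hSm A w hA hA0 hw0 hS hS'
      (fun p τ => G p.1 τ (g τ (R τ p.1 p.2 + η τ (R τ p.1 p.2))))
      (aux_cont2 G R hG hR g hgc η hη) (fun p τ hτ => hbd _ _ hτ _)
  · intro t b
    rw [← hκ t, ← integral_const_mul]
    apply norm_integral_le_of_norm_le ((hwi t).const_mul (A t))
    filter_upwards [ae_restrict_mem (hSm t)] with τ hτ using hbd t τ hτ _
  · intro V hV η' hη' M hM t b hbV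
    rw [← integral_sub (hint η hη t b) (hint η' hη' t b), mul_comm κ, ← hκ t,
      ← integral_const_mul, ← integral_const_mul]
    apply norm_integral_le_of_norm_le (((hwi t).const_mul (A t)).const_mul M)
    filter_upwards [ae_restrict_mem (hSm t)] with τ hτ
    rw [← map_sub]
    refine (hb t τ hτ _ _).trans (mul_le_mul_of_nonneg_right ?_ (mul_nonneg (hA0 t) (hw0 τ)))
    rw [add_sub_add_left_eq_sub]
    exact (min_le_right _ _).trans (hM τ _ (hV t τ hτ b hbV))

end side

section mu
variable (μ : ℝ → ℝ)

theorem aux_deriv (hμpos : ∀ t, 0 < μ t) (hμdiff : Differentiable ℝ μ) (a : ℝ) (ha : a ≠ 0)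
    (t : ℝ) : HasDerivAt (fun t => μ t ^ a / a) (μ t ^ (a - 1) * deriv μ t) t := by
  have := ((hμdiff t).hasDerivAt.rpow_const (p := a) (Or.inl (hμpos t).ne')).div_const a
  convert! this using 1
  field_simp

theorem aux_Iic_s11 (hμpos : ∀ t, 0 < μ t) (hμmono : StrictMono μ)
    (hμbot : Tendsto μ atBot (nhds 0))
    (hμdiff : Differentiable ℝ μ) (a : ℝ) (ha : 0 < a) (t : ℝ) :
    IntegrableOn (fun τ => μ τ ^ (a - 1) * deriv μ τ) (Set.Iic t) ∧
    ∫ τ in Set.Iic t, μ τ ^ (a - 1) * deriv μ τ = μ t ^ a / a := by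
  have hd := aux_deriv μ hμpos hμdiff a ha.ne'
  have hlim : Tendsto (fun t => μ t ^ a / a) atBot (nhds 0) := by
    have := (hμbot.rpow_const (p := a) (Or.inr ha.le)).div_const a
    simpa [Real.zero_rpow ha.ne'] using this
  have hi : IntegrableOn (fun τ => μ τ ^ (a - 1) * deriv μ τ) (Set.Iic t) := by
    have h1 : IntegrableOn (fun x => μ (-x) ^ (a - 1) * deriv μ (-x)) (Set.Ioi (-t)) := by
      apply integrableOn_Ioi_deriv_of_nonneg' (g := fun x => -(μ (-x) ^ a / a)) (l := 0)
      · intro x _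
        have := ((hd (-x)).comp x (hasDerivAt_neg x)).neg
        convert! this using 1
        ring
      · intro x _
        exact mul_nonneg (Real.rpow_nonneg (hμpos _).le _) (hμmono.monotone.deriv_nonneg)
      · simpa using (hlim.comp tendsto_neg_atTop_atBot).neg
    have h2 := (Iff.mpr integrableOn_Ici_iff_integrableOn_Ioi h1).comp_neg_Iic
    simpa using h2
  refine ⟨hi, ?_⟩
  rw [integral_Iic_of_hasDerivAt_of_tendsto' (fun x _ => hd x) hi hlim, sub_zero]

theorem aux_Ici_s11 (hμpos : ∀ t, 0 < μ t) (hμmono : StrictMono μ)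
    (hμtop : Tendsto μ atTop atTop)
    (hμdiff : Differentiable ℝ μ) (b : ℝ) (hb : 0 < b) (t : ℝ) :
    IntegrableOn (fun τ => μ τ ^ (-b - 1) * deriv μ τ) (Set.Ici t) ∧
    ∫ τ in Set.Ici t, μ τ ^ (-b - 1) * deriv μ τ = μ t ^ (-b) / b := by
  have hd := aux_deriv μ hμpos hμdiff (-b) (neg_ne_zero.2 hb.ne')
  have hlim : Tendsto (fun t => μ t ^ (-b) / (-b)) atTop (nhds 0) := by
    have := ((tendsto_rpow_neg_atTop hb).comp hμtop).div_const (-b)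
    simpa using this
  have hn : ∀ x ∈ Set.Ioi t, 0 ≤ μ x ^ (-b - 1) * deriv μ x := fun x _ =>
    mul_nonneg (Real.rpow_nonneg (hμpos _).le _) (hμmono.monotone.deriv_nonneg)
  refine ⟨Iff.mpr integrableOn_Ici_iff_integrableOn_Ioi
    (integrableOn_Ioi_deriv_of_nonneg' (fun x _ => hd x) hn hlim), ?_⟩
  rw [integral_Ici_eq_integral_Ioi, integral_Ioi_of_hasDerivAt_of_nonneg' (fun x _ => hd x) hn hlim]
  rw [div_neg]; ring

theorem aux_kernel (hμpos : ∀ t, 0 < μ t) (hμmono : StrictMono μ) (hμ0 : μ 0 = 1)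
    (a D δ θ ε γ m G x : ℝ) (hD : 0 < D) (hδ : 0 < δ) (hγ : θ < γ) (hm : 0 ≤ m) (t τ : ℝ)
    (hx0 : 0 ≤ x)
    (hG : G ≤ D * (μ t / μ τ) ^ (-a) * μ τ ^ (Real.sign τ * (θ + ε)))
    (hx : x ≤ δ * m * deriv μ τ * μ τ ^ (-(Real.sign τ) * (γ + ε) - 1)) :
    G * x ≤ m * (D * δ * μ t ^ (-a) * (μ τ ^ (a - 1) * deriv μ τ)) := by
  have hp := hμpos τ
  have hd : 0 ≤ deriv μ τ := hμmono.monotone.deriv_nonneg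
  have h1 : μ τ ^ (Real.sign τ * (θ - γ)) ≤ 1 := by
    rcases lt_trichotomy τ 0 with h | h | h
    · rw [Real.sign_of_neg h]
      exact Real.rpow_le_one hp.le (by rw [← hμ0]; exact (hμmono h).le) (by linarith)
    · simp [h]
    · rw [Real.sign_of_pos h]
      exact Real.rpow_le_one_of_one_le_of_nonpos (by rw [← hμ0]; exact (hμmono h).le) (by linarith)
  have h2 : (μ t / μ τ) ^ (-a) = μ t ^ (-a) * μ τ ^ a := by
    rw [Real.div_rpow (hμpos t).le hp.le, Real.rpow_neg hp.le, div_inv_eq_mul]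
  have h3 : μ τ ^ a * (μ τ ^ (Real.sign τ * (θ + ε)) * μ τ ^ (-(Real.sign τ) * (γ + ε) - 1))
      = μ τ ^ (a - 1) * μ τ ^ (Real.sign τ * (θ - γ)) := by
    rw [← Real.rpow_add hp, ← Real.rpow_add hp, ← Real.rpow_add hp]
    congr 1; ring
  have hK : 0 ≤ D * (μ t / μ τ) ^ (-a) * μ τ ^ (Real.sign τ * (θ + ε)) :=
    mul_nonneg (mul_nonneg hD.le (Real.rpow_nonneg (div_pos (hμpos t) hp).le _))
      (Real.rpow_nonneg hp.le _)
  have hW : 0 ≤ m * (D * δ * μ t ^ (-a) * (μ τ ^ (a - 1) * deriv μ τ)) := by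
    have := (Real.rpow_pos_of_pos (hμpos t) (-a)).le
    have := (Real.rpow_pos_of_pos hp (a - 1)).le
    positivity
  calc G * x ≤ _ := mul_le_mul hG hx hx0 hK
    _ = (D * δ * m * μ t ^ (-a) * deriv μ τ) * (μ τ ^ a * (μ τ ^ (Real.sign τ * (θ + ε)) *
          μ τ ^ (-(Real.sign τ) * (γ + ε) - 1))) := by rw [h2]; ring
    _ = (m * (D * δ * μ t ^ (-a) * (μ τ ^ (a - 1) * deriv μ τ))) *
          μ τ ^ (Real.sign τ * (θ - γ)) := by rw [h3]; ring
    _ ≤ _ := mul_le_of_le_one_right hW h1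

end mu

/-- Topological-equivalence theorem, fixed-point form: if moreover
`Dδ(α+β)/(αβ) < 1`, then there is a unique bounded (continuous) `η` on the bundle
`{(t,b) : b ∈ U(t)}` with `F(η) = η`, and it satisfies
`‖η‖_∞ ≤ Dδ(α+β)/(αβ) < 1`. -/
theorem stmt11 {n : ℕ}
    {C : Type*} [NormedAddCommGroup C] [NormedSpace ℝ C] [CompleteSpace C]
    (μ : ℝ → ℝ)
    (hμpos : ∀ t, 0 < μ t) (hμmono : StrictMono μ) (hμ0 : μ 0 = 1)
    (hμtop : Tendsto μ atTop atTop) (hμbot : Tendsto μ atBot (nhds 0))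
    (hμdiff : Differentiable ℝ μ)
    (α β D δ θ ν ε γ : ℝ)
    (hα : 0 < α) (hβ : 0 < β) (hD : 0 < D) (hδ : 0 < δ)
    (hθ : 0 ≤ θ) (hν : 0 ≤ ν) (hε : 0 ≤ ε) (hγ : max θ ν < γ)
    (U : ℝ → Submodule ℝ C) (hUcl : ∀ t, IsClosed (U t : Set C))
    (Tb T : ℝ → ℝ → C →L[ℝ] C)
    (hTbU : ∀ τ t : ℝ, τ ≤ t → ∀ b ∈ U t, Tb τ t b ∈ U τ)
    (hTU : ∀ τ t : ℝ, t ≤ τ → ∀ b ∈ U t, T τ t b ∈ U τ)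
    (hTbc : ∀ b : C, Continuous fun p : ℝ × ℝ => Tb p.1 p.2 b)
    (hTc : ∀ b : C, Continuous fun p : ℝ × ℝ => T p.1 p.2 b)
    (Gs Gu : ℝ → ℝ → (Fin n → ℝ) →L[ℝ] C)
    (hGs : ∀ τ t : ℝ, τ ≤ t →
      ‖Gs t τ‖ ≤ D * (μ t / μ τ) ^ (-α) * μ τ ^ (Real.sign τ * (θ + ε)))
    (hGu : ∀ τ t : ℝ, t ≤ τ →
      ‖Gu t τ‖ ≤ D * (μ t / μ τ) ^ β * μ τ ^ (Real.sign τ * (ν + ε)))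
    (hGsc : ∀ p : Fin n → ℝ, Continuous fun q : ℝ × ℝ => Gs q.1 q.2 p)
    (hGuc : ∀ p : Fin n → ℝ, Continuous fun q : ℝ × ℝ => Gu q.1 q.2 p)
    (g : ℝ → C → Fin n → ℝ)
    (hgc : Continuous fun p : ℝ × C => g p.1 p.2)
    (hg0 : ∀ t, g t 0 = 0)
    (hglip : ∀ (t : ℝ) (φ ψ : C), ‖g t φ - g t ψ‖ ≤
      δ * min 1 ‖φ - ψ‖ * deriv μ t * μ t ^ (-(Real.sign t) * (γ + ε) - 1))
    -- smallness condition
    (hsmall : D * δ * (α + β) / (α * β) < 1) :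
    ∃ η : ℝ → C → C,
      (Continuous fun p : ℝ × C => η p.1 p.2) ∧
      (∃ M : ℝ, ∀ t : ℝ, ∀ b ∈ U t, ‖η t b‖ ≤ M) ∧
      (∀ t : ℝ, ∀ b ∈ U t, Fop Gs Gu Tb T g η t b = η t b) ∧
      (∀ t : ℝ, ∀ b ∈ U t, ‖η t b‖ ≤ D * δ * (α + β) / (α * β)) ∧
      (∀ η' : ℝ → C → C,
        (Continuous fun p : ℝ × C => η' p.1 p.2) →
        (∃ M : ℝ, ∀ t : ℝ, ∀ b ∈ U t, ‖η' t b‖ ≤ M) →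
        (∀ t : ℝ, ∀ b ∈ U t, Fop Gs Gu Tb T g η' t b = η' t b) →
        ∀ t : ℝ, ∀ b ∈ U t, η' t b = η t b) := by
  have hw0 : ∀ a τ : ℝ, 0 ≤ μ τ ^ (a - 1) * deriv μ τ := fun a τ =>
    mul_nonneg (Real.rpow_nonneg (hμpos _).le _) (hμmono.monotone.deriv_nonneg)
  have hA : ∀ a : ℝ, Continuous fun t => D * δ * μ t ^ (-a) := fun a =>
    continuous_const.mul (hμdiff.continuous.rpow_const fun t => Or.inl (hμpos t).ne')
  have hA0 : ∀ a t : ℝ, 0 ≤ D * δ * μ t ^ (-a) := fun a t =>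
    mul_nonneg (mul_pos hD hδ).le (Real.rpow_nonneg (hμpos _).le _)
  have hsS := aux_side (fun t => Set.Iic t) (fun t => measurableSet_Iic)
    (fun t => D * δ * μ t ^ (-α)) (fun τ => μ τ ^ (α - 1) * deriv μ τ) (hA α) (hA0 α) (hw0 α)
    (fun t0 => ⟨Set.Iic (t0 + 1), measurableSet_Iic,
      (aux_Iic_s11 μ hμpos hμmono hμbot hμdiff α hα _).1, by
        filter_upwards [Iio_mem_nhds (lt_add_one t0)] with t ht
        exact Set.Iic_subset_Iic.2 (le_of_lt ht)⟩)
    (fun t0 τ hτ => by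
      rcases lt_or_gt_of_ne hτ with h | h
      · filter_upwards [Ioi_mem_nhds h] with t ht
        have ht' : τ < t := ht
        simp only [Set.mem_Iic, Set.mem_Ici]; constructor <;> intro <;> linarith
      · filter_upwards [Iio_mem_nhds h] with t ht
        have ht' : t < τ := ht
        simp only [Set.mem_Iic, Set.mem_Ici]; constructor <;> intro <;> linarith)
    (D * δ / α)
    (fun t => by
      rw [(aux_Iic_s11 μ hμpos hμmono hμbot hμdiff α hα _).2, Real.rpow_neg (hμpos t).le]
      have := (Real.rpow_pos_of_pos (hμpos t) α).ne'
      field_simp)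
    Gs Tb hGsc hTbc g hgc hg0
    (fun t τ hτ φ ψ => ((Gs t τ).le_opNorm _).trans
      (aux_kernel μ hμpos hμmono hμ0 α D δ θ ε γ _ _ _ hD hδ ((le_max_left _ _).trans_lt hγ)
        (le_min zero_le_one (norm_nonneg _)) t τ (norm_nonneg _) (hGs τ t hτ) (hglip τ φ ψ)))
  have hsU := aux_side (fun t => Set.Ici t) (fun t => measurableSet_Ici)
    (fun t => D * δ * μ t ^ (-(-β))) (fun τ => μ τ ^ (-β - 1) * deriv μ τ)
    (hA (-β)) (hA0 (-β)) (hw0 (-β))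
    (fun t0 => ⟨Set.Ici (t0 - 1), measurableSet_Ici,
      (aux_Ici_s11 μ hμpos hμmono hμtop hμdiff β hβ _).1, by
        filter_upwards [Ioi_mem_nhds (sub_one_lt t0)] with t ht
        exact Set.Ici_subset_Ici.2 (le_of_lt ht)⟩)
    (fun t0 τ hτ => by
      rcases lt_or_gt_of_ne hτ with h | h
      · filter_upwards [Ioi_mem_nhds h] with t ht
        have ht' : τ < t := ht
        simp only [Set.mem_Iic, Set.mem_Ici]; constructor <;> intro <;> linarith
      · filter_upwards [Iio_mem_nhds h] with t ht
        have ht' : t < τ := ht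
        simp only [Set.mem_Iic, Set.mem_Ici]; constructor <;> intro <;> linarith)
    (D * δ / β)
    (fun t => by
      rw [(aux_Ici_s11 μ hμpos hμmono hμtop hμdiff β hβ _).2, neg_neg, Real.rpow_neg (hμpos t).le]
      have := (Real.rpow_pos_of_pos (hμpos t) β).ne'
      field_simp)
    Gu T hGuc hTc g hgc hg0
    (fun t τ hτ φ ψ => ((Gu t τ).le_opNorm _).trans
      (aux_kernel μ hμpos hμmono hμ0 (-β) D δ ν ε γ _ _ _ hD hδ ((le_max_right _ _).trans_lt hγ)
        (le_min zero_le_one (norm_nonneg _)) t τ (norm_nonneg _)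
        (by rw [neg_neg]; exact hGu τ t hτ) (hglip τ φ ψ)))
  set K := D * δ * (α + β) / (α * β) with hK
  have hKeq : D * δ / α + D * δ / β = K := by rw [hK]; field_simp; ring
  have hK0 : 0 ≤ K := by rw [hK]; positivity
  have hFc : ∀ η : ℝ → C → C, (Continuous fun p : ℝ × C => η p.1 p.2) →
      Continuous fun p : ℝ × C => Fop Gs Gu Tb T g η p.1 p.2 := fun η hη =>
    (hsS η hη).1.sub (hsU η hη).1
  have hFb : ∀ η : ℝ → C → C, (Continuous fun p : ℝ × C => η p.1 p.2) →
      ∀ t b, ‖Fop Gs Gu Tb T g η t b‖ ≤ K := fun η hη t b => by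
    rw [← hKeq]
    exact (norm_sub_le _ _).trans (add_le_add ((hsS η hη).2.1 t b) ((hsU η hη).2.1 t b))
  have hFd : ∀ V : ℝ → Set C, (∀ τ t : ℝ, τ ≤ t → ∀ b ∈ V t, Tb τ t b ∈ V τ) →
      (∀ τ t : ℝ, t ≤ τ → ∀ b ∈ V t, T τ t b ∈ V τ) →
      ∀ η : ℝ → C → C, (Continuous fun p : ℝ × C => η p.1 p.2) →
      ∀ η' : ℝ → C → C, (Continuous fun p : ℝ × C => η' p.1 p.2) →
      ∀ M : ℝ, (∀ t, ∀ b ∈ V t, ‖η t b - η' t b‖ ≤ M) →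
      ∀ t, ∀ b ∈ V t, ‖Fop Gs Gu Tb T g η t b - Fop Gs Gu Tb T g η' t b‖ ≤ K * M := by
    intro V hV1 hV2 η hη η' hη' M hM t b hb
    rw [← hKeq, add_mul]
    have h1 := (hsS η hη).2.2 V (fun t τ h b hb => hV1 τ t h b hb) η' hη' M hM t b hb
    have h2 := (hsU η hη).2.2 V (fun t τ h b hb => hV2 τ t h b hb) η' hη' M hM t b hb
    unfold Fop
    rw [sub_sub_sub_comm]
    exact (norm_sub_le _ _).trans (add_le_add h1 h2)
  let Φ : BoundedContinuousFunction (ℝ × C) C → BoundedContinuousFunction (ℝ × C) C := fun f =>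
    BoundedContinuousFunction.ofNormedAddCommGroup
      (fun p => Fop Gs Gu Tb T g (fun t b => f (t, b)) p.1 p.2)
      (hFc _ f.continuous) K (fun p => hFb _ f.continuous p.1 p.2)
  have hΦ : ContractingWith ⟨K, hK0⟩ Φ := by
    refine ⟨hsmall, LipschitzWith.of_dist_le_mul fun f f' => ?_⟩
    change dist (Φ f) (Φ f') ≤ K * dist f f'
    rw [BoundedContinuousFunction.dist_le (mul_nonneg hK0 dist_nonneg)]
    intro p
    rw [dist_eq_norm]
    exact hFd (fun _ => Set.univ) (fun _ _ _ _ _ => trivial) (fun _ _ _ _ _ => trivial)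
      _ f.continuous _ f'.continuous (dist f f')
      (fun t b _ => by rw [← dist_eq_norm]; exact f.dist_coe_le_dist (t, b)) p.1 p.2 trivial
  let f := hΦ.fixedPoint Φ
  have hf : Φ f = f := hΦ.fixedPoint_isFixedPt
  have hfix : ∀ t b, Fop Gs Gu Tb T g (fun t b => f (t, b)) t b = f (t, b) := fun t b =>
    congrArg (fun F : BoundedContinuousFunction (ℝ × C) C => F (t, b)) hf
  have hfb : ∀ t b, ‖f (t, b)‖ ≤ K := fun t b => by
    rw [← hfix]; exact hFb _ f.continuous t b
  refine ⟨fun t b => f (t, b), f.continuous, ⟨K, fun t b _ => hfb t b⟩, fun t b _ => hfix t b,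
    fun t b _ => hfb t b, ?_⟩
  rintro η' hη' ⟨M, hM⟩ hfix' t b hb
  have hit : ∀ k : ℕ, ∀ t, ∀ b ∈ (U t : Set C), ‖η' t b - f (t, b)‖ ≤ K ^ k * (M + K) := by
    intro k
    induction k with
    | zero =>
      intro t b hb
      rw [pow_zero, one_mul]
      exact (norm_sub_le _ _).trans (add_le_add (hM t b hb) (hfb t b))
    | succ k ih =>
      intro t b hb
      have := hFd (fun t => (U t : Set C)) hTbU hTU η' hη' (fun t b => f (t, b)) f.continuous
        _ ih t b hb
      rw [hfix' t b hb, hfix t b] at this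
      rw [pow_succ']
      linarith
  have hlim : Tendsto (fun k : ℕ => K ^ k * (M + K)) atTop (nhds 0) := by
    simpa using (tendsto_pow_atTop_nhds_zero_of_lt_one hK0 hsmall).mul_const (M + K)
  have := ge_of_tendsto' hlim (fun k => hit k t b hb)
  exact sub_eq_zero.1 (norm_le_zero_iff.1 this)
end

section
/- Let μ be a differentiable growth rate, and let a ≥ 0, β > 0 and ξ > 0 satisfy 2ξ > |a − β| and ξ ≥ a − β. Then for every t ≤ 0, μ(t)^{β−a+ξ} · ( ∫_{t}^{0} μ(τ)^{a−β+2ξ−1} μ′(τ) dτ + ∫_{0}^{+∞} μ(τ)^{a−β−2ξ−1} μ′(τ) dτ ) ≤ 4ξ/(4ξ² − (a−β)²). -/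
open Filter MeasureTheory

/-- for a differentiable growth rate `μ` and `a ≥ 0`, `β > 0`, `ξ > 0`
with `2ξ > |a − β|` and `ξ ≥ a − β`, for every `t ≤ 0`,
`μ(t)^{β−a+ξ} ( ∫_{t}^{0} μ^{a−β+2ξ−1} μ′ + ∫_{0}^{+∞} μ^{a−β−2ξ−1} μ′ ) ≤ 4ξ/(4ξ² − (a−β)²)`. -/
theorem stmt13 (μ : ℝ → ℝ)
    (hμpos : ∀ t, 0 < μ t) (hμmono : StrictMono μ) (hμ0 : μ 0 = 1)
    (hμtop : Tendsto μ atTop atTop) (hμbot : Tendsto μ atBot (nhds 0))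
    (hμdiff : Differentiable ℝ μ)
    (a β ξ : ℝ) (ha : 0 ≤ a) (hβ : 0 < β) (hξ : 0 < ξ)
    (h1 : |a - β| < 2 * ξ) (h2 : a - β ≤ ξ) :
    ∀ t : ℝ, t ≤ 0 →
      μ t ^ (β - a + ξ) *
        ((∫ τ in t..(0 : ℝ), μ τ ^ (a - β + 2 * ξ - 1) * deriv μ τ) +
          ∫ τ in Set.Ici (0 : ℝ), μ τ ^ (a - β - 2 * ξ - 1) * deriv μ τ) ≤
        4 * ξ / (4 * ξ ^ 2 - (a - β) ^ 2) := by
  intro t ht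
  obtain ⟨hl, hr⟩ := abs_lt.mp h1
  have hp : 0 < a - β + 2 * ξ := by linarith
  have hq : 0 < 2 * ξ - (a - β) := by linarith
  have hd : ∀ p : ℝ, p ≠ 0 → ∀ x, HasDerivAt (fun τ => μ τ ^ p / p)
      (μ x ^ (p - 1) * deriv μ x) x := by
    intro p hp0 x
    have h := ((hμdiff x).hasDerivAt.rpow_const (p := p) (Or.inl (hμpos x).ne')).div_const p
    refine h.congr_deriv ?_
    rw [mul_right_comm, mul_div_assoc, div_self hp0, mul_one, mul_comm]
  have hnn : ∀ p x : ℝ, 0 ≤ μ x ^ p * deriv μ x := fun p x =>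
    mul_nonneg (Real.rpow_nonneg (hμpos x).le _) (hμmono.monotone.deriv_nonneg)
  have hI1 : (∫ τ in t..(0 : ℝ), μ τ ^ (a - β + 2 * ξ - 1) * deriv μ τ)
      = 1 / (a - β + 2 * ξ) - μ t ^ (a - β + 2 * ξ) / (a - β + 2 * ξ) := by
    rw [intervalIntegral.integral_eq_sub_of_hasDerivAt (fun x _ => hd _ hp.ne' x)
      (intervalIntegral.intervalIntegrable_deriv_of_nonneg
        (fun x _ => (hd _ hp.ne' x).continuousAt.continuousWithinAt)
        (fun x _ => hd _ hp.ne' x) (fun x _ => hnn _ x))]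
    simp [hμ0]
  have hI2 : (∫ τ in Set.Ici (0 : ℝ), μ τ ^ (a - β - 2 * ξ - 1) * deriv μ τ)
      = 1 / (2 * ξ - (a - β)) := by
    have hq' : a - β - 2 * ξ ≠ 0 := by linarith
    have hlim : Tendsto (fun τ => μ τ ^ (a - β - 2 * ξ) / (a - β - 2 * ξ)) atTop (nhds 0) := by
      have h := ((tendsto_rpow_neg_atTop hq).comp hμtop).div_const (a - β - 2 * ξ)
      rw [zero_div] at h
      convert h using 4
      simp [Function.comp]
    rw [integral_Ici_eq_integral_Ioi,
      integral_Ioi_of_hasDerivAt_of_nonneg' (fun x _ => hd _ hq' x) (fun x _ => hnn _ x) hlim]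
    rw [hμ0, Real.one_rpow, ← neg_sub (2 * ξ) (a - β), zero_sub, div_neg, neg_neg]
  rw [hI1, hI2]
  have hμt : μ t ≤ 1 := hμ0 ▸ hμmono.monotone ht
  have hA : μ t ^ (β - a + ξ) ≤ 1 := Real.rpow_le_one (hμpos t).le hμt (by linarith)
  have hA0 : 0 ≤ μ t ^ (β - a + ξ) := Real.rpow_nonneg (hμpos t).le _
  have hB : 0 ≤ μ t ^ (a - β + 2 * ξ) / (a - β + 2 * ξ) :=
    div_nonneg (Real.rpow_nonneg (hμpos t).le _) hp.le
  have hsum : 4 * ξ / (4 * ξ ^ 2 - (a - β) ^ 2)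
      = 1 / (a - β + 2 * ξ) + 1 / (2 * ξ - (a - β)) := by
    rw [div_add_div _ _ hp.ne' hq.ne']
    congr 1 <;> ring
  have hS : 0 ≤ 1 / (a - β + 2 * ξ) + 1 / (2 * ξ - (a - β)) := by positivity
  rw [hsum]
  calc _ ≤ μ t ^ (β - a + ξ) * (1 / (a - β + 2 * ξ) + 1 / (2 * ξ - (a - β))) :=
        mul_le_mul_of_nonneg_left (by linarith) hA0
    _ ≤ _ := mul_le_of_le_one_left hS hA
end
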